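/- Under the hypotheses of Theorem 1.1 (1 ≤ p_k < ∞, 1/p = Σ 1/p_k, ω⃗ ∈ A_{P⃗} ∩ (A_∞)^m, v a weight, (φ⃗₁,φ₂) satisfying [φ⃗₁,φ₂]₁ < ∞), suppose the m-sublinear operator T satisfies the pointwise size condition |T(f⃗)(x)| ≲ ∫_{(ℝⁿ)^m} ( ∏_{i=1}^m |fᵢ(yᵢ)| ) / ( Σ_{j=1}^m |x − y_j| )^{mn} dy⃗ for all f⃗ ∈ ∏ᵢ M^{pᵢ,φ₁ᵢ}(ωᵢ) and all x ∉ ∩_{j=1}^m supp f_j. Then: (i) if min_k p_k > 1, T ∈ LB(∏_{i=1}^m M^{pᵢ,φ₁ᵢ}(ωᵢ) → M^{p,φ₂}(v)) if and only if T is bounded from M^{p₁,φ₁₁}(ω₁) × ⋯ × M^{pₘ,φ₁ₘ}(ωₘ) to M^{p,φ₂}(v); (ii) if min_k p_k = 1, T ∈ LB(∏ᵢ M^{pᵢ,φ₁ᵢ}(ωᵢ) → WM^{p,φ₂}(v)) if and only if T is bounded from ∏ᵢ M^{pᵢ,φ₁ᵢ}(ωᵢ) to WM^{p,φ₂}(v).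 -/

import Mathlib

open MeasureTheory Metric Set Filter Function
open scoped ENNReal NNReal BigOperators Topology FourierTransform

noncomputable section

/-- Euclidean space `ℝⁿ`. -/
abbrev Rn (n : ℕ) : Type := EuclideanSpace ℝ (Fin n)

namespace GWM

variable {n m : ℕ}

/-- The weighted measure `ω(E) = ∫_E ω(x) dx`. -/
def wMeas (ω : Rn n → ℝ) (E : Set (Rn n)) : ℝ≥0∞ :=
  ∫⁻ x in E, ENNReal.ofReal (ω x)

/-- `(∫_E g(x)^p ω(x) dx)^(1/p)` for an `ℝ≥0∞`-valued `g`. -/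
def wLpNormE (p : ℝ) (ω : Rn n → ℝ) (E : Set (Rn n)) (g : Rn n → ℝ≥0∞) : ℝ≥0∞ :=
  (∫⁻ x in E, g x ^ p * ENNReal.ofReal (ω x)) ^ (1 / p)

/-- The weighted Lebesgue norm `‖f‖_{L^p(E, ω dx)}`. -/
def wLpNorm (p : ℝ) (ω : Rn n → ℝ) (E : Set (Rn n)) (f : Rn n → ℝ) : ℝ≥0∞ :=
  wLpNormE p ω E fun x => ENNReal.ofReal |f x|

/-- The weak weighted Lebesgue norm, `ℝ≥0∞`-valued version. -/
def wWeakLpNormE (p : ℝ) (ω : Rn n → ℝ) (E : Set (Rn n)) (g : Rn n → ℝ≥0∞) : ℝ≥0∞ :=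
  ⨆ (α : ℝ) (_ : 0 < α), ENNReal.ofReal α * wMeas ω {x ∈ E | ENNReal.ofReal α < g x} ^ (1 / p)

/-- The weak weighted Lebesgue norm `‖f‖_{WL^p(E, ω dx)}`. -/
def wWeakLpNorm (p : ℝ) (ω : Rn n → ℝ) (E : Set (Rn n)) (f : Rn n → ℝ) : ℝ≥0∞ :=
  wWeakLpNormE p ω E fun x => ENNReal.ofReal |f x|

/-- The generalized weighted Morrey norm (`ℝ≥0∞`-valued function version). -/
def morreyNormE (p : ℝ) (φ : Rn n → ℝ → ℝ) (ω : Rn n → ℝ) (g : Rn n → ℝ≥0∞) : ℝ≥0∞ :=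
  ⨆ (x : Rn n) (r : ℝ) (_ : 0 < r),
    (ENNReal.ofReal (φ x r))⁻¹ * wMeas ω (ball x r) ^ (-(1 / p)) * wLpNormE p ω (ball x r) g

/-- The generalized weighted Morrey norm `‖f‖_{M^{p,φ}(ω)}`. -/
def morreyNorm (p : ℝ) (φ : Rn n → ℝ → ℝ) (ω : Rn n → ℝ) (f : Rn n → ℝ) : ℝ≥0∞ :=
  morreyNormE p φ ω fun x => ENNReal.ofReal |f x|

/-- The weak generalized weighted Morrey norm (`ℝ≥0∞`-valued version). -/
def weakMorreyNormE (p : ℝ) (φ : Rn n → ℝ → ℝ) (ω : Rn n → ℝ) (g : Rn n → ℝ≥0∞) : ℝ≥0∞ :=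
  ⨆ (x : Rn n) (r : ℝ) (_ : 0 < r),
    (ENNReal.ofReal (φ x r))⁻¹ * wMeas ω (ball x r) ^ (-(1 / p)) * wWeakLpNormE p ω (ball x r) g

/-- The weak generalized weighted Morrey norm `‖f‖_{WM^{p,φ}(ω)}`. -/
def weakMorreyNorm (p : ℝ) (φ : Rn n → ℝ → ℝ) (ω : Rn n → ℝ) (f : Rn n → ℝ) : ℝ≥0∞ :=
  weakMorreyNormE p φ ω fun x => ENNReal.ofReal |f x|

/-- The generalized local weighted Morrey norm at `x₀` (`ℝ≥0∞`-valued version). -/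
def localMorreyNormE (x₀ : Rn n) (p : ℝ) (φ : Rn n → ℝ → ℝ) (ω : Rn n → ℝ)
    (g : Rn n → ℝ≥0∞) : ℝ≥0∞ :=
  ⨆ (r : ℝ) (_ : 0 < r),
    (ENNReal.ofReal (φ x₀ r))⁻¹ * wMeas ω (ball x₀ r) ^ (-(1 / p)) * wLpNormE p ω (ball x₀ r) g

/-- The generalized local weighted Morrey norm `‖f‖_{M_{x₀}^{p,φ}(ω)}`. -/
def localMorreyNorm (x₀ : Rn n) (p : ℝ) (φ : Rn n → ℝ → ℝ) (ω : Rn n → ℝ)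
    (f : Rn n → ℝ) : ℝ≥0∞ :=
  localMorreyNormE x₀ p φ ω fun x => ENNReal.ofReal |f x|

/-- The weak generalized local weighted Morrey norm (`ℝ≥0∞`-valued version). -/
def localWeakMorreyNormE (x₀ : Rn n) (p : ℝ) (φ : Rn n → ℝ → ℝ) (ω : Rn n → ℝ)
    (g : Rn n → ℝ≥0∞) : ℝ≥0∞ :=
  ⨆ (r : ℝ) (_ : 0 < r),
    (ENNReal.ofReal (φ x₀ r))⁻¹ * wMeas ω (ball x₀ r) ^ (-(1 / p)) *
      wWeakLpNormE p ω (ball x₀ r) g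

/-- The weak generalized local weighted Morrey norm `‖f‖_{WM_{x₀}^{p,φ}(ω)}`. -/
def localWeakMorreyNorm (x₀ : Rn n) (p : ℝ) (φ : Rn n → ℝ → ℝ) (ω : Rn n → ℝ)
    (f : Rn n → ℝ) : ℝ≥0∞ :=
  localWeakMorreyNormE x₀ p φ ω fun x => ENNReal.ofReal |f x|

/-- Membership in the generalized weighted Morrey space `M^{p,φ}(ω)`. -/
def MemMorrey (p : ℝ) (φ : Rn n → ℝ → ℝ) (ω : Rn n → ℝ) (f : Rn n → ℝ) : Prop :=
  LocallyIntegrable f volume ∧ morreyNorm p φ ω f < ⊤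

/-- Membership in the generalized local weighted Morrey space `M_{x₀}^{p,φ}(ω)`. -/
def MemLocalMorrey (x₀ : Rn n) (p : ℝ) (φ : Rn n → ℝ → ℝ) (ω : Rn n → ℝ)
    (f : Rn n → ℝ) : Prop :=
  LocallyIntegrable f volume ∧ localMorreyNorm x₀ p φ ω f < ⊤

/-- A weight: a nonnegative locally integrable function, positive a.e. -/
def IsWeight (ω : Rn n → ℝ) : Prop :=
  LocallyIntegrable ω volume ∧ (∀ x, 0 ≤ ω x) ∧
    ∀ᵐ x ∂(volume : Measure (Rn n)), 0 < ω x

/-- The Muckenhoupt class `A₁`. -/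
def IsA1 (ω : Rn n → ℝ) : Prop :=
  ∃ C : ℝ≥0, ∀ (x : Rn n) (r : ℝ), 0 < r →
    wMeas ω (ball x r) ≤ C * volume (ball x r) *
      essInf (fun y => ENNReal.ofReal (ω y)) (volume.restrict (ball x r))

/-- The Muckenhoupt class `A_q`, `1 < q < ∞`. -/
def IsAq (q : ℝ) (ω : Rn n → ℝ) : Prop :=
  ∃ C : ℝ≥0, ∀ (x : Rn n) (r : ℝ), 0 < r →
    (volume (ball x r))⁻¹ * wMeas ω (ball x r) *
      ((volume (ball x r))⁻¹ *
        ∫⁻ y in ball x r, ENNReal.ofReal (ω y) ^ (-(1 / (q - 1)))) ^ (q - 1) ≤ C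

/-- The Muckenhoupt class `A_∞ = ⋃_{1 ≤ q < ∞} A_q`. -/
def IsAinf (ω : Rn n → ℝ) : Prop := IsA1 ω ∨ ∃ q : ℝ, 1 < q ∧ IsAq q ω

/-- The multiple weight `ν_{ω⃗} = ∏ ωᵢ^{p/pᵢ}`. -/
def nuw (p : ℝ) (ps : Fin m → ℝ) (ωs : Fin m → Rn n → ℝ) : Rn n → ℝ :=
  fun x => ∏ i, ωs i x ^ (p / ps i)

/-- The factor `(|B|⁻¹ ∫_B ωᵢ^{1-pᵢ'})^{1/pᵢ'}` in the `A_{P⃗}` condition, with the usual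
modification `(essinf_B ωᵢ)⁻¹` when `pᵢ = 1`. -/
def APfactor (q : ℝ) (ω : Rn n → ℝ) (E : Set (Rn n)) : ℝ≥0∞ :=
  if q = 1 then (essInf (fun y => ENNReal.ofReal (ω y)) (volume.restrict E))⁻¹
  else ((volume E)⁻¹ * ∫⁻ y in E, ENNReal.ofReal (ω y) ^ (-(1 / (q - 1)))) ^ ((q - 1) / q)

/-- The multiple Muckenhoupt condition `ω⃗ ∈ A_{P⃗}`. -/
def IsMultiAP (p : ℝ) (ps : Fin m → ℝ) (ωs : Fin m → Rn n → ℝ) : Prop :=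
  ∃ C : ℝ≥0, ∀ (x : Rn n) (r : ℝ), 0 < r →
    ((volume (ball x r))⁻¹ * wMeas (nuw p ps ωs) (ball x r)) ^ (1 / p) *
      ∏ i, APfactor (ps i) (ωs i) (ball x r) ≤ C

/-- The average `b_E = |E|⁻¹ ∫_E b`. -/
def ballAvg (b : Rn n → ℝ) (E : Set (Rn n)) : ℝ := (∫ y in E, b y) / (volume E).toReal

/-- The BMO norm `‖b‖_{BMO} = sup_B |B|⁻¹ ∫_B |b - b_B|`. -/
def bmoNorm (b : Rn n → ℝ) : ℝ≥0∞ :=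
  ⨆ (x : Rn n) (r : ℝ) (_ : 0 < r),
    (volume (ball x r))⁻¹ * ∫⁻ y in ball x r, ENNReal.ofReal |b y - ballAvg b (ball x r)|

/-- `b ∈ BMO`. -/
def MemBMO (b : Rn n → ℝ) : Prop := LocallyIntegrable b volume ∧ bmoNorm b < ⊤

/-- `f⁰ = f·χ_{2B}` for the ball `B = B(x₀,r)`. -/
def loc0 (x₀ : Rn n) (r : ℝ) (f : Rn n → ℝ) : Rn n → ℝ := (ball x₀ (2 * r)).indicator f

/-- `f^∞ = f·χ_{(2B)ᶜ}` for the ball `B = B(x₀,r)`. -/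
def locInf (x₀ : Rn n) (r : ℝ) (f : Rn n → ℝ) : Rn n → ℝ := (ball x₀ (2 * r))ᶜ.indicator f

/-- `Σ_{j=1}^∞ ∏_{i=1}^m |2^{j+1}B|⁻¹ ∫_{2^{j+1}B} |fᵢ|`, for `B = B(x₀,r)`. -/
def lsSum (x₀ : Rn n) (r : ℝ) (f : Fin m → Rn n → ℝ) : ℝ≥0∞ :=
  ∑' j : ℕ, ∏ i, (volume (ball x₀ (2 ^ (j + 2) * r)))⁻¹ *
    ∫⁻ y in ball x₀ (2 ^ (j + 2) * r), ENNReal.ofReal |f i y|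

/-- The local size condition `T ∈ LS(∏ Xᵢ)`. -/
def LS (T : (Fin m → Rn n → ℝ) → Rn n → ℝ) (X : Fin m → (Rn n → ℝ) → Prop) : Prop :=
  ∃ C : ℝ≥0, ∀ (x₀ : Rn n) (r : ℝ), 0 < r → ∀ f : Fin m → Rn n → ℝ, (∀ i, X i (f i)) →
    ∀ ℓ : ℕ, 1 ≤ ℓ → ℓ ≤ m →
      essSup
        (fun x => ENNReal.ofReal
          |T (fun i => if (i : ℕ) < ℓ then locInf x₀ r (f i) else loc0 x₀ r (f i)) x|)
        (volume.restrict (ball x₀ r)) ≤ C * lsSum x₀ r f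

/-- The local boundedness condition `T ∈ LB(∏ Xᵢ → Y)`. -/
def LB (T : (Fin m → Rn n → ℝ) → Rn n → ℝ) (X : Fin m → (Rn n → ℝ) → Prop)
    (Xnorm : Fin m → (Rn n → ℝ) → ℝ≥0∞) (Ynorm : (Rn n → ℝ) → ℝ≥0∞) : Prop :=
  ∃ C : ℝ≥0, ∀ (x₀ : Rn n) (r : ℝ), 0 < r → ∀ f : Fin m → Rn n → ℝ, (∀ i, X i (f i)) →
    Ynorm (T fun i => loc0 x₀ r (f i)) ≤ C * ∏ i, Xnorm i (f i)

/-- `T` is `m`-sublinear (subadditive in each entry). -/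
def MSublinear (T : (Fin m → Rn n → ℝ) → Rn n → ℝ) : Prop :=
  ∀ (f : Fin m → Rn n → ℝ) (i : Fin m) (g h : Rn n → ℝ) (x : Rn n),
    |T (Function.update f i (g + h)) x| ≤
      |T (Function.update f i g) x| + |T (Function.update f i h) x|

/-- Pointwise size condition `|T(f⃗)(x)| ≲ ∫ ∏|fᵢ(yᵢ)| (Σ|x-yⱼ|)^{-mn} dy⃗`
for `x ∉ ⋂ supp fⱼ`. -/
def PointwiseSize (T : (Fin m → Rn n → ℝ) → Rn n → ℝ)
    (X : Fin m → (Rn n → ℝ) → Prop) : Prop :=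
  ∃ C : ℝ≥0, ∀ f : Fin m → Rn n → ℝ, (∀ i, X i (f i)) →
    ∀ x : Rn n, x ∉ ⋂ j, Function.support (f j) →
      ENNReal.ofReal |T f x| ≤
        C * ∫⁻ y : Fin m → Rn n,
          (∏ i, ENNReal.ofReal |f i (y i)|) *
            ENNReal.ofReal (∑ j, dist x (y j)) ^ (-(m * n : ℝ))

/-- The iterated commutator `T_{Π b⃗}`. -/
def iterComm (T : (Fin m → Rn n → ℝ) → Rn n → ℝ) (b f : Fin m → Rn n → ℝ) : Rn n → ℝ :=
  fun x => T (fun i y => (b i x - b i y) * f i y) x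

/-- The multilinear commutator `T_{Σ b⃗}`. -/
def sumComm (T : (Fin m → Rn n → ℝ) → Rn n → ℝ) (b f : Fin m → Rn n → ℝ) : Rn n → ℝ :=
  fun x => ∑ j, T (Function.update f j fun y => (b j x - b j y) * f j y) x

/-- `essinf_{t<η<∞} ∏ᵢ φ₁ᵢ(x,η) ωᵢ(B(x,η))^{1/pᵢ}`. -/
def essInfProd (ps : Fin m → ℝ) (φ1 : Fin m → Rn n → ℝ → ℝ) (ωs : Fin m → Rn n → ℝ)
    (x : Rn n) (t : ℝ) : ℝ≥0∞ :=
  essInf (fun η => ∏ i, ENNReal.ofReal (φ1 i x η) * wMeas (ωs i) (ball x η) ^ (1 / ps i))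
    (volume.restrict (Ioi t))

/-- The quantity inside the supremum in the conditions `[φ⃗₁,φ₂]` (with logarithmic factor
`(1+log(t/r))^k`). -/
def phiCondAt (k : ℕ) (ps : Fin m → ℝ) (φ1 : Fin m → Rn n → ℝ → ℝ)
    (ωs : Fin m → Rn n → ℝ) (φ2 : Rn n → ℝ → ℝ) (x : Rn n) (r : ℝ) : ℝ≥0∞ :=
  (ENNReal.ofReal (φ2 x r))⁻¹ *
    ∫⁻ t in Ioi r,
      ENNReal.ofReal (1 + Real.log (t / r)) ^ k * essInfProd ps φ1 ωs x t *
        (∏ i, wMeas (ωs i) (ball x t) ^ (1 / ps i))⁻¹ * (ENNReal.ofReal t)⁻¹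

/-- The condition `[φ⃗₁,φ₂] < ∞` (`k = 0`: condition `[·]₁`; `k = m`: condition `[·]₂`;
`k = 1`: condition `[·]₃`). -/
def phiCond (k : ℕ) (ps : Fin m → ℝ) (φ1 : Fin m → Rn n → ℝ → ℝ)
    (ωs : Fin m → Rn n → ℝ) (φ2 : Rn n → ℝ → ℝ) : Prop :=
  (⨆ (x : Rn n) (r : ℝ) (_ : 0 < r), phiCondAt k ps φ1 ωs φ2 x r) < ⊤

/-- The local (at `x₀`) condition `[φ⃗₁,φ₂]' < ∞`. -/
def phiCondLoc (x₀ : Rn n) (k : ℕ) (ps : Fin m → ℝ) (φ1 : Fin m → Rn n → ℝ → ℝ)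
    (ωs : Fin m → Rn n → ℝ) (φ2 : Rn n → ℝ → ℝ) : Prop :=
  (⨆ (r : ℝ) (_ : 0 < r), phiCondAt k ps φ1 ωs φ2 x₀ r) < ⊤



/-! ### Variable exponent spaces -/

/-- The Luxemburg norm `‖f‖_{L^{p(·)}}`. -/
def luxNorm (p : Rn n → ℝ) (f : Rn n → ℝ) : ℝ≥0∞ :=
  ⨅ (lam : ℝ≥0∞) (_ : lam ≠ 0)
    (_ : (∫⁻ x, (ENNReal.ofReal |f x| / lam) ^ p x) ≤ 1), lam

/-- `‖f‖_{L^{p(·)}(E)} = ‖f χ_E‖_{L^{p(·)}}`. -/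
def luxNormOn (p : Rn n → ℝ) (E : Set (Rn n)) (f : Rn n → ℝ) : ℝ≥0∞ :=
  luxNorm p (E.indicator f)

/-- `p(·) ∈ 𝒫`: measurable with `1 < p⁻ ≤ p⁺ < ∞`. -/
def MemP (p : Rn n → ℝ) : Prop :=
  Measurable p ∧ ∃ a b : ℝ, 1 < a ∧ ∀ x, a ≤ p x ∧ p x ≤ b

/-- `p(·) ∈ LH`: global log-Hölder continuity. -/
def LogHolder (p : Rn n → ℝ) : Prop :=
  (∃ C : ℝ, ∀ x y : Rn n, 0 < dist x y → dist x y ≤ 1 / 2 →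
    |p x - p y| ≤ C / (-Real.log (dist x y))) ∧
  (∃ C : ℝ, ∀ x y : Rn n, ‖x‖ ≤ ‖y‖ →
    |p x - p y| ≤ C / Real.log (Real.exp 1 + ‖x‖))

/-- The conjugate exponent function `p'(·) = p(·)/(p(·)-1)`. -/
def conjExp (p : Rn n → ℝ) : Rn n → ℝ := fun x => p x / (p x - 1)

/-- The variable exponent Muckenhoupt class `A_{p(·)}`. -/
def IsAvar (p : Rn n → ℝ) (ω : Rn n → ℝ) : Prop :=
  ∃ C : ℝ≥0, ∀ (x : Rn n) (r : ℝ), 0 < r →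
    (volume (ball x r))⁻¹ * luxNormOn p (ball x r) ω *
      luxNormOn (conjExp p) (ball x r) (fun y => (ω y)⁻¹) ≤ C

/-- The generalized weighted variable exponent Morrey norm `‖f‖_{M^{p(·),φ}(ω)}`. -/
def varMorreyNorm (p : Rn n → ℝ) (φ : Rn n → ℝ → ℝ) (ω f : Rn n → ℝ) : ℝ≥0∞ :=
  ⨆ (x : Rn n) (r : ℝ) (_ : 0 < r),
    (ENNReal.ofReal (φ x r))⁻¹ * (luxNormOn p (ball x r) ω)⁻¹ *
      luxNormOn p (ball x r) (fun y => ω y * f y)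

/-- Membership in `M^{p(·),φ}(ω)`. -/
def MemVarMorrey (p : Rn n → ℝ) (φ : Rn n → ℝ → ℝ) (ω f : Rn n → ℝ) : Prop :=
  LocallyIntegrable f volume ∧ varMorreyNorm p φ ω f < ⊤

/-- `essinf_{t<η<∞} ∏ᵢ φ₁ᵢ(x,η) ‖ωᵢ‖_{L^{pᵢ(·)}(B(x,η))}`. -/
def varEssInfProd (ps : Fin m → Rn n → ℝ) (φ1 : Fin m → Rn n → ℝ → ℝ)
    (ωs : Fin m → Rn n → ℝ) (x : Rn n) (t : ℝ) : ℝ≥0∞ :=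
  essInf (fun η => ∏ i, ENNReal.ofReal (φ1 i x η) * luxNormOn (ps i) (ball x η) (ωs i))
    (volume.restrict (Ioi t))

/-- The variable exponent condition `[φ⃗₁,φ₂]'' < ∞` (with log factor `(1+log(t/r))^k`). -/
def varPhiCond (k : ℕ) (ps : Fin m → Rn n → ℝ) (φ1 : Fin m → Rn n → ℝ → ℝ)
    (ωs : Fin m → Rn n → ℝ) (φ2 : Rn n → ℝ → ℝ) : Prop :=
  (⨆ (x : Rn n) (r : ℝ) (_ : 0 < r),
    (ENNReal.ofReal (φ2 x r))⁻¹ *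
      ∫⁻ t in Ioi r,
        ENNReal.ofReal (1 + Real.log (t / r)) ^ k * varEssInfProd ps φ1 ωs x t *
          (∏ i, luxNormOn (ps i) (ball x t) (ωs i))⁻¹ * (ENNReal.ofReal t)⁻¹) < ⊤

/-! ### Lebesgue norms on all of `ℝⁿ` -/

/-- `(∫ g^q)^(1/q)` for `ℝ≥0∞`-valued `g`. -/
def lpNormE (q : ℝ) (g : Rn n → ℝ≥0∞) : ℝ≥0∞ := (∫⁻ x, g x ^ q) ^ (1 / q)

/-- The (unweighted) `L^q(ℝⁿ)` norm. -/
def lpNormRn (q : ℝ) (f : Rn n → ℝ) : ℝ≥0∞ := lpNormE q fun x => ENNReal.ofReal |f x|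

/-! ### Quasi-Banach valued Calderón–Zygmund operators -/

/-- A quasi-norm making `E` a quasi-Banach space. -/
structure QBNorm (E : Type) [AddCommGroup E] [Module ℝ E] where
  N : E → ℝ
  nonneg : ∀ e, 0 ≤ N e
  eq_zero_iff : ∀ e, N e = 0 ↔ e = 0
  smul_eq : ∀ (c : ℝ) (e : E), N (c • e) = |c| * N e
  kappa : ℝ
  one_le_kappa : 1 ≤ kappa
  quasi : ∀ e₁ e₂, N (e₁ + e₂) ≤ kappa * (N e₁ + N e₂)
  complete : ∀ u : ℕ → E,
    (∀ ε : ℝ, 0 < ε → ∃ M : ℕ, ∀ j k, M ≤ j → M ≤ k → N (u j - u k) < ε) →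
    ∃ e : E, ∀ ε : ℝ, 0 < ε → ∃ M : ℕ, ∀ j, M ≤ j → N (u j - e) < ε

/-- An `m`-linear `𝔅`-valued Calderón–Zygmund operator on `ℝⁿ`, together with its kernel,
defined on products of generalized weighted Morrey spaces via the decomposition
`T(f⃗) = Σ_{α⃗} T(f₁^{α₁},…,f_m^{α_m})`. -/
structure MultiCZB (n m : ℕ) (E : Type) [AddCommGroup E] [Module ℝ E] (Q : QBNorm E) where
  T : (Fin m → Rn n → ℝ) → Rn n → E
  K : Rn n → (Fin m → Rn n) → E
  add_coord : ∀ (f : Fin m → Rn n → ℝ) (i : Fin m) (g h : Rn n → ℝ) (x : Rn n),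
    T (Function.update f i (g + h)) x = T (Function.update f i g) x + T (Function.update f i h) x
  smul_coord : ∀ (f : Fin m → Rn n → ℝ) (i : Fin m) (c : ℝ) (g : Rn n → ℝ) (x : Rn n),
    T (Function.update f i (c • g)) x = c • T (Function.update f i g) x
  eps : ℝ
  eps_pos : 0 < eps
  A : ℝ≥0
  size : ∀ (x : Rn n) (y : Fin m → Rn n), 0 < ∑ j, dist x (y j) →
    ENNReal.ofReal (Q.N (K x y)) ≤ A * ENNReal.ofReal (∑ j, dist x (y j)) ^ (-(m * n : ℝ))
  reg_y : ∀ (x : Rn n) (y : Fin m → Rn n) (i : Fin m) (y' : Rn n),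
    0 < ∑ j, dist x (y j) → dist (y i) y' ≤ (1 / 2) * ⨆ j, dist x (y j) →
    ENNReal.ofReal (Q.N (K x y - K x (Function.update y i y'))) ≤
      A * ENNReal.ofReal (dist (y i) y' ^ eps) *
        ENNReal.ofReal (∑ j, dist x (y j)) ^ (-(m * n : ℝ) - eps)
  reg_x : ∀ (x x' : Rn n) (y : Fin m → Rn n),
    0 < ∑ j, dist x (y j) → dist x x' ≤ (1 / 2) * ∑ j, dist x (y j) →
    ENNReal.ofReal (Q.N (K x y - K x' y)) ≤
      A * ENNReal.ofReal (dist x x' ^ eps) *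
        ENNReal.ofReal (∑ j, dist x (y j)) ^ (-(m * n : ℝ) - eps)
  dom : ∀ (f : Fin m → Rn n → ℝ) (x : Rn n), x ∉ ⋂ j, tsupport (f j) →
    ENNReal.ofReal (Q.N (T f x)) ≤
      ∫⁻ y : Fin m → Rn n, (∏ i, ENNReal.ofReal |f i (y i)|) * ENNReal.ofReal (Q.N (K x y))
  decomp : ∀ (f : Fin m → Rn n → ℝ) (x₀ : Rn n) (r : ℝ), 0 < r → ∀ x ∈ ball x₀ r,
    T f x = ∑ α : Fin m → Bool,
      T (fun i => if α i then locInf x₀ r (f i) else loc0 x₀ r (f i)) x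
  bddLq : ∃ (qs : Fin m → ℝ) (q : ℝ) (C : ℝ≥0), (∀ i, 1 ≤ qs i) ∧ q⁻¹ = ∑ i, (qs i)⁻¹ ∧
    ∀ f : Fin m → Rn n → ℝ,
      lpNormE q (fun x => ENNReal.ofReal (Q.N (T f x))) ≤ C * ∏ i, lpNormRn (qs i) (f i)

/-! ### Multilinear Littlewood–Paley square operators -/

/-- `K_t(x,y⃗) = t^{-mn} K(x/t, y₁/t, …, y_m/t)`. -/
def Kt (m : ℕ) (K : Rn n → (Fin m → Rn n) → ℝ) (t : ℝ) (x : Rn n)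
    (y : Fin m → Rn n) : ℝ :=
  t ^ (-(m * n : ℝ)) * K (t⁻¹ • x) fun i => t⁻¹ • y i

/-- The multilinear square operator
`T(f⃗)(x) = (∫₀^∞ |∫ K_t(x,y⃗) ∏ fⱼ(yⱼ) dy⃗|² dt/t)^{1/2}`. -/
def sqFn (K : Rn n → (Fin m → Rn n) → ℝ) (f : Fin m → Rn n → ℝ) (x : Rn n) : ℝ≥0∞ :=
  (∫⁻ t in Ioi (0 : ℝ),
      ENNReal.ofReal |∫ y : Fin m → Rn n, Kt m K t x y * ∏ i, f i (y i)| ^ (2 : ℝ) *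
        (ENNReal.ofReal t)⁻¹) ^ (1 / 2 : ℝ)

/-- `θ ∈ Dini(1)`: nondecreasing on `[0,∞)`, `0 < θ(1) < ∞`, `∫₀¹ θ(t)/t dt < ∞`. -/
def IsDiniFn (θ : ℝ → ℝ) : Prop :=
  (∀ t, 0 ≤ θ t) ∧ MonotoneOn θ (Ici 0) ∧ 0 < θ 1 ∧
    (∫⁻ t in Ioo (0 : ℝ) 1, ENNReal.ofReal (θ t) * (ENNReal.ofReal t)⁻¹) < ⊤

/-- `K` is a square-function kernel of type `θ`. -/
def SqKernelType (K : Rn n → (Fin m → Rn n) → ℝ) (θ : ℝ → ℝ) : Prop :=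
  ∃ A : ℝ≥0,
    (∀ (x : Rn n) (y : Fin m → Rn n), 0 < ∑ j, dist x (y j) →
      (∫⁻ t in Ioi (0 : ℝ),
          ENNReal.ofReal |Kt m K t x y| ^ (2 : ℝ) * (ENNReal.ofReal t)⁻¹) ^ (1 / 2 : ℝ) ≤
        A * ENNReal.ofReal (∑ j, dist x (y j)) ^ (-(m * n : ℝ))) ∧
    (∀ (x : Rn n) (y : Fin m → Rn n) (i : Fin m) (y' : Rn n), 0 < ∑ j, dist x (y j) →
      dist (y i) y' ≤ (1 / 2) * ⨆ j, dist x (y j) →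
      (∫⁻ t in Ioi (0 : ℝ),
          ENNReal.ofReal |Kt m K t x y - Kt m K t x (Function.update y i y')| ^ (2 : ℝ) *
            (ENNReal.ofReal t)⁻¹) ^ (1 / 2 : ℝ) ≤
        A * ENNReal.ofReal (∑ j, dist x (y j)) ^ (-(m * n : ℝ)) *
          ENNReal.ofReal (θ (dist (y i) y' / ∑ j, dist x (y j)))) ∧
    (∀ (x z : Rn n) (y : Fin m → Rn n), 0 < ∑ j, dist x (y j) →
      dist z x ≤ (1 / 2) * ⨆ j, dist x (y j) →
      (∫⁻ t in Ioi (0 : ℝ),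
          ENNReal.ofReal |Kt m K t z y - Kt m K t x y| ^ (2 : ℝ) *
            (ENNReal.ofReal t)⁻¹) ^ (1 / 2 : ℝ) ≤
        A * ENNReal.ofReal (∑ j, dist x (y j)) ^ (-(m * n : ℝ)) *
          ENNReal.ofReal (θ (dist z x / ∑ j, dist x (y j))))

/-- The assumed `L^{q₁} × ⋯ × L^{q_m} → L^q` boundedness of the square operator. -/
def SqBddLq (K : Rn n → (Fin m → Rn n) → ℝ) : Prop :=
  ∃ (qs : Fin m → ℝ) (q : ℝ) (C : ℝ≥0), (∀ i, 1 < qs i) ∧ q⁻¹ = ∑ i, (qs i)⁻¹ ∧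
    ∀ f : Fin m → Rn n → ℝ, lpNormE q (sqFn K f) ≤ C * ∏ i, lpNormRn (qs i) (f i)

/-- A multilinear Littlewood–Paley kernel. -/
def IsMLPKernel (K : Rn n → (Fin m → Rn n) → ℝ) : Prop :=
  ∃ A γ δ B₁ : ℝ, 0 < A ∧ 0 < γ ∧ 0 < δ ∧ 0 < B₁ ∧
    (∀ (x : Rn n) (y : Fin m → Rn n),
      |K x y| ≤ A * (1 + ∑ j, dist x (y j)) ^ (-(m * n : ℝ) - δ)) ∧
    (∀ (x : Rn n) (y : Fin m → Rn n) (i : Fin m) (y' : Rn n),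
      dist (y i) y' ≤ dist x (y i) / B₁ →
      |K x y - K x (Function.update y i y')| ≤
        A * dist (y i) y' ^ γ * (1 + ∑ j, dist x (y j)) ^ (-(m * n : ℝ) - δ - γ)) ∧
    (∀ (x x' : Rn n) (y : Fin m → Rn n),
      dist x x' ≤ (⨆ j, dist x (y j)) / B₁ →
      |K x y - K x' y| ≤
        A * dist x x' ^ γ * (1 + ∑ j, dist x (y j)) ^ (-(m * n : ℝ) - δ - γ))

/-- The multilinear Littlewood–Paley `g*_λ` function. -/
def glam (K : Rn n → (Fin m → Rn n) → ℝ) (lam : ℝ) (f : Fin m → Rn n → ℝ)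
    (x : Rn n) : ℝ≥0∞ :=
  (∫⁻ t in Ioi (0 : ℝ), ∫⁻ z : Rn n,
      ENNReal.ofReal (t / (dist x z + t)) ^ (n * lam) *
        ENNReal.ofReal |∫ y : Fin m → Rn n, Kt m K t z y * ∏ i, f i (y i)| ^ (2 : ℝ) *
          (ENNReal.ofReal t) ^ (-(n : ℝ) - 1)) ^ (1 / 2 : ℝ)

/-- The assumed `L^{q₁} × ⋯ × L^{q_m} → L^q` boundedness of the `g*_λ` function. -/
def GlamBddLq (K : Rn n → (Fin m → Rn n) → ℝ) (lam : ℝ) : Prop :=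
  ∃ (qs : Fin m → ℝ) (q : ℝ) (C : ℝ≥0), (∀ i, 1 < qs i) ∧ q⁻¹ = ∑ i, (qs i)⁻¹ ∧
    ∀ f : Fin m → Rn n → ℝ, lpNormE q (glam K lam f) ≤ C * ∏ i, lpNormRn (qs i) (f i)

/-- A multilinear Marcinkiewicz kernel. -/
def IsMarcinkiewiczKernel (K : Rn n → (Fin m → Rn n) → ℝ) : Prop :=
  ∃ A γ δ B₁ : ℝ, 0 < A ∧ 0 < γ ∧ 0 < δ ∧ δ < m * n ∧ 0 < B₁ ∧
    (∀ (x : Rn n) (y : Fin m → Rn n), ¬ (∑ j, dist x (y j) ^ 2) ≤ 1 → K x y = 0) ∧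
    (∀ (x : Rn n) (y : Fin m → Rn n), 0 < ∑ j, dist x (y j) →
      |K x y| ≤ A * (∑ j, dist x (y j)) ^ (-(m * n : ℝ) + δ)) ∧
    (∀ (x : Rn n) (y : Fin m → Rn n) (i : Fin m) (y' : Rn n),
      (∑ j, dist x (y j) ^ 2) ≤ 1 → 0 < ∑ j, dist x (y j) →
      dist (y i) y' ≤ dist x (y i) / B₁ →
      |K x y - K x (Function.update y i y')| ≤
        A * dist (y i) y' ^ γ * (∑ j, dist x (y j)) ^ (-(m * n : ℝ) + δ - γ)) ∧
    (∀ (x x' : Rn n) (y : Fin m → Rn n),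
      (∑ j, dist x (y j) ^ 2) ≤ 1 → 0 < ∑ j, dist x (y j) →
      dist x x' ≤ (⨆ j, dist x (y j)) / B₁ →
      |K x y - K x' y| ≤
        A * dist x x' ^ γ * (∑ j, dist x (y j)) ^ (-(m * n : ℝ) + δ - γ))

/-- `|z⃗| = (Σ |zᵢ|²)^{1/2}` on `(ℝⁿ)^m`. -/
def rho (m : ℕ) (z : Fin m → Rn n) : ℝ := Real.sqrt (∑ i, ‖z i‖ ^ 2)

/-- A multilinear Marcinkiewicz kernel of convolution type with homogeneous `Ω`. -/
def IsConvHomogMarcinkiewicz (K : Rn n → (Fin m → Rn n) → ℝ) : Prop :=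
  IsMarcinkiewiczKernel K ∧
  ∃ (Kc : (Fin m → Rn n) → ℝ) (Ω : (Fin m → Rn n) → ℝ) (δ : ℝ),
    0 < δ ∧ δ < m * n ∧
    (∀ (x : Rn n) (y : Fin m → Rn n), K x y = Kc fun i => x - y i) ∧
    (∀ (c : ℝ) (z : Fin m → Rn n), 0 < c → Ω (c • z) = Ω z) ∧
    (∀ z : Fin m → Rn n, Kc z = if rho m z ≤ 1 then Ω z * rho m z ^ (δ - m * n) else 0)
/-! ### Scalar (complex) multilinear operators: norms, commutators, conclusions -/

/-- View a real function as a complex one. -/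
def cToC (f : Rn n → ℝ) : Rn n → ℂ := fun y => (f y : ℂ)

/-- `x ↦ |T(f⃗)(x)|` for a complex-valued multilinear operator applied to real data. -/
def cNorm (Tc : (Fin m → Rn n → ℂ) → Rn n → ℂ) (f : Fin m → Rn n → ℝ) : Rn n → ℝ≥0∞ :=
  fun x => ENNReal.ofReal ‖Tc (fun i => cToC (f i)) x‖

/-- `x ↦ |T_{Πb⃗}(f⃗)(x)|`. -/
def cIterComm (Tc : (Fin m → Rn n → ℂ) → Rn n → ℂ) (b f : Fin m → Rn n → ℝ) :
    Rn n → ℝ≥0∞ :=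
  fun x => ENNReal.ofReal ‖Tc (fun i y => (((b i x - b i y) * f i y : ℝ) : ℂ)) x‖

/-- `x ↦ |T_{Σb⃗}(f⃗)(x)|`. -/
def cSumComm (Tc : (Fin m → Rn n → ℂ) → Rn n → ℂ) (b f : Fin m → Rn n → ℝ) :
    Rn n → ℝ≥0∞ :=
  fun x => ENNReal.ofReal
    ‖∑ j, Tc (Function.update (fun i => cToC (f i)) j
        fun y => (((b j x - b j y) * f j y : ℝ) : ℂ)) x‖

/-- The boundedness conclusions of Theorems 4.1–4.3 for a complex `m`-linear operator:
strong and weak type on generalized weighted Morrey spaces under `[φ⃗₁,φ₂]₁ < ∞`, and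
boundedness of the iterated/multilinear commutators under `[φ⃗₁,φ₂]₂ < ∞` resp.
`[φ⃗₁,φ₂]₃ < ∞`. -/
def Thm41to43Concl (m : ℕ) (Tc : (Fin m → Rn n → ℂ) → Rn n → ℂ) : Prop :=
  ∀ (ps : Fin m → ℝ) (p : ℝ) (ωs : Fin m → Rn n → ℝ)
    (φ1 : Fin m → Rn n → ℝ → ℝ) (φ2 : Rn n → ℝ → ℝ),
    (∀ k, 1 ≤ ps k) → p⁻¹ = ∑ k, (ps k)⁻¹ → (∀ i, IsWeight (ωs i)) →
    IsMultiAP p ps ωs → (∀ i, IsAinf (ωs i)) →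
    (∀ i x r, 0 < r → 0 ≤ φ1 i x r) → (∀ x r, 0 < r → 0 ≤ φ2 x r) →
    ((phiCond 0 ps φ1 ωs φ2 →
      ((∀ k, 1 < ps k) → ∃ C : ℝ≥0, ∀ f : Fin m → Rn n → ℝ,
        (∀ i, MemMorrey (ps i) (φ1 i) (ωs i) (f i)) →
        morreyNormE p φ2 (nuw p ps ωs) (cNorm Tc f) ≤
          C * ∏ i, morreyNorm (ps i) (φ1 i) (ωs i) (f i)) ∧
      ((∃ k, ps k = 1) → ∃ C : ℝ≥0, ∀ f : Fin m → Rn n → ℝ,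
        (∀ i, MemMorrey (ps i) (φ1 i) (ωs i) (f i)) →
        weakMorreyNormE p φ2 (nuw p ps ωs) (cNorm Tc f) ≤
          C * ∏ i, morreyNorm (ps i) (φ1 i) (ωs i) (f i))) ∧
    ((∀ k, 1 < ps k) → ∀ b : Fin m → Rn n → ℝ, (∀ j, MemBMO (b j)) →
      (phiCond m ps φ1 ωs φ2 → ∃ C : ℝ≥0, ∀ f : Fin m → Rn n → ℝ,
        (∀ i, MemMorrey (ps i) (φ1 i) (ωs i) (f i)) →
        morreyNormE p φ2 (nuw p ps ωs) (cIterComm Tc b f) ≤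
          C * ∏ i, morreyNorm (ps i) (φ1 i) (ωs i) (f i)) ∧
      (phiCond 1 ps φ1 ωs φ2 → ∃ C : ℝ≥0, ∀ f : Fin m → Rn n → ℝ,
        (∀ i, MemMorrey (ps i) (φ1 i) (ωs i) (f i)) →
        morreyNormE p φ2 (nuw p ps ωs) (cSumComm Tc b f) ≤
          C * ∏ i, morreyNorm (ps i) (φ1 i) (ωs i) (f i))))

/-! ### Multilinear pseudo-differential operators -/

/-- Standard basis directions in `ℝⁿ × (ℝⁿ)^m`: `inl i` is the `i`-th direction in the
`x`-variable, `inr (j,i)` the `i`-th direction in the `j`-th `ξ`-variable. -/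
def dirVec (n m : ℕ) : Fin n ⊕ Fin m × Fin n → Rn n × (Fin m → Rn n)
  | Sum.inl i => (EuclideanSpace.single i 1, 0)
  | Sum.inr ji => (0, Pi.single ji.1 (EuclideanSpace.single ji.2 1))

/-- The multilinear Hörmander class `S⁰`: smooth with
`|∂_x^α ∂_{ξ⃗}^{β⃗} σ| ≤ C (1+Σ|ξᵢ|)^{|α| - |β⃗|}`. -/
def SymbolClass (m : ℕ) (σ : Rn n × (Fin m → Rn n) → ℂ) : Prop :=
  ContDiff ℝ (⊤ : ℕ∞) σ ∧
  ∀ (k : ℕ) (d : Fin k → Fin n ⊕ Fin m × Fin n), ∃ C : ℝ,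
    ∀ (x : Rn n) (ξ : Fin m → Rn n),
      ‖iteratedFDeriv ℝ k σ (x, ξ) fun j => dirVec n m (d j)‖ ≤
        C * (1 + ∑ i, ‖ξ i‖) ^
          (((Finset.univ.filter fun j => (d j).isLeft = true).card : ℝ) -
            ((Finset.univ.filter fun j => (d j).isRight = true).card : ℝ))

/-- The `m`-linear pseudo-differential operator with symbol `σ`. -/
def Tpseudo (m : ℕ) (σ : Rn n × (Fin m → Rn n) → ℂ) (f : Fin m → Rn n → ℂ)
    (x : Rn n) : ℂ :=
  ∫ ξ : Fin m → Rn n,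
    σ (x, ξ) * (∏ i, 𝓕 (f i) (ξ i)) *
      Complex.exp (2 * Real.pi * Complex.I * ((∑ i, (inner ℝ x (ξ i) : ℝ) : ℝ) : ℂ))

/-- `T'` is the `j`-th transpose of `T`. -/
def IsTransposeOf (m : ℕ) (T T' : (Fin m → Rn n → ℂ) → Rn n → ℂ) (j : Fin m) : Prop :=
  ∀ (f : Fin m → Rn n → ℂ) (g : Rn n → ℂ),
    (∀ i, ContDiff ℝ (⊤ : ℕ∞) (f i) ∧ HasCompactSupport (f i)) →
    ContDiff ℝ (⊤ : ℕ∞) g → HasCompactSupport g →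
    ∫ x, T f x * g x = ∫ x, T' (Function.update f j g) x * f j x

/-! ### Paraproducts -/

/-- `Ψ_t(x) = t^{-n} Ψ(x/t)`. -/
def dilat (Ψ : Rn n → ℂ) (t : ℝ) : Rn n → ℂ :=
  fun x => ((t ^ (-(n : ℝ)) : ℝ) : ℂ) * Ψ (t⁻¹ • x)

/-- The Littlewood–Paley piece `Δ_j^Ψ f = f * Ψ_{2^{-j}}`. -/
def DeltaJ (Ψ : Rn n → ℂ) (j : ℤ) (f : Rn n → ℂ) : Rn n → ℂ :=
  fun x => ∫ y, f y * dilat Ψ ((2 : ℝ) ^ (-j)) (x - y)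

/-- The partial sum `S_j f = Σ_{k ≤ j} Δ_k^Ψ f`. -/
def SJ (Ψ : Rn n → ℂ) (j : ℤ) (f : Rn n → ℂ) : Rn n → ℂ :=
  fun x => ∑' k : ℤ, if k ≤ j then DeltaJ Ψ k f x else 0

/-- The bilinear paraproduct `Π₂(f₁,f₂) = Σ_j Δ_j^Ψ(f₁) S_j(f₂)`. -/
def paraprod2 (Ψ : Rn n → ℂ) : (Fin 2 → Rn n → ℂ) → Rn n → ℂ :=
  fun f x => ∑' j : ℤ, DeltaJ Ψ j (f 0) x * SJ Ψ j (f 1) x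

/-- The trilinear paraproduct `Π₃(f₁,f₂,f₃) = Σ_j Δ_j^Ψ(f₁) S_j(f₂) S_j(f₃)`. -/
def paraprod3 (Ψ : Rn n → ℂ) : (Fin 3 → Rn n → ℂ) → Rn n → ℂ :=
  fun f x => ∑' j : ℤ, DeltaJ Ψ j (f 0) x * SJ Ψ j (f 1) x * SJ Ψ j (f 2) x

/-- `Ψ` is a Schwartz function whose Fourier transform is supported in the annulus
`6/7 ≤ |ξ| ≤ 2` and equal to `1` on `1 ≤ |ξ| ≤ 12/7`. -/
def IsLPBump (Ψ : Rn n → ℂ) : Prop :=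
  (∃ S : SchwartzMap (Rn n) ℂ, Ψ = ⇑S) ∧
  Function.support (𝓕 Ψ) ⊆ {ξ : Rn n | 6 / 7 ≤ ‖ξ‖ ∧ ‖ξ‖ ≤ 2} ∧
  ∀ ξ : Rn n, 1 ≤ ‖ξ‖ → ‖ξ‖ ≤ 12 / 7 → 𝓕 Ψ ξ = 1

lemma rpow_add_le_two_rpow_mul (a b : ℝ≥0∞) {p : ℝ} (hp : 0 ≤ p) :
    (a + b) ^ p ≤ 2 ^ p * (a ^ p + b ^ p) := by
  calc (a + b) ^ p ≤ (2 * max a b) ^ p := by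
        refine ENNReal.rpow_le_rpow ?_ hp
        rw [two_mul]
        exact add_le_add (le_max_left _ _) (le_max_right _ _)
    _ = 2 ^ p * (max a b) ^ p := ENNReal.mul_rpow_of_nonneg _ _ hp
    _ ≤ 2 ^ p * (a ^ p + b ^ p) := by
        gcongr
        rcases le_total a b with h | h
        · rw [max_eq_right h]; exact le_add_self
        · rw [max_eq_left h]; exact le_self_add

lemma wLpNormE_le_add_const {p : ℝ} (hp : 0 < p) {v : Rn n → ℝ} (hv : AEMeasurable v volume)
    {E : Set (Rn n)} (hE : MeasurableSet E) {g a : Rn n → ℝ≥0∞} {c : ℝ≥0∞}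
    (h : ∀ x ∈ E, g x ≤ a x + c) :
    wLpNormE p v E g ≤ 2 * 2 ^ (1 / p) * (wLpNormE p v E a + c * wMeas v E ^ (1 / p)) := by
  have hp' : (0 : ℝ) ≤ 1 / p := by positivity
  have hvE : AEMeasurable (fun x => ENNReal.ofReal (v x)) (volume.restrict E) :=
    hv.ennreal_ofReal.restrict
  have key : ∫⁻ x in E, g x ^ p * ENNReal.ofReal (v x) ≤
      2 ^ p * ((∫⁻ x in E, a x ^ p * ENNReal.ofReal (v x)) + c ^ p * wMeas v E) := by
    calc ∫⁻ x in E, g x ^ p * ENNReal.ofReal (v x)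
        ≤ ∫⁻ x in E, 2 ^ p * (a x ^ p * ENNReal.ofReal (v x) + c ^ p * ENNReal.ofReal (v x)) := by
          refine setLIntegral_mono_ae' hE (ae_of_all _ fun x hx => ?_)
          rw [← add_mul, ← mul_assoc]
          gcongr
          exact (ENNReal.rpow_le_rpow (h x hx) hp.le).trans (rpow_add_le_two_rpow_mul _ _ hp.le)
      _ = _ := by
          rw [lintegral_const_mul' _ _ (by simp),
            lintegral_add_right' _ (hvE.const_mul _), lintegral_const_mul'' _ hvE]
          rfl
  unfold wLpNormE
  calc _ ≤ (2 ^ p * ((∫⁻ x in E, a x ^ p * ENNReal.ofReal (v x)) + c ^ p * wMeas v E)) ^ (1 / p) :=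
        ENNReal.rpow_le_rpow key hp'
    _ = 2 * ((∫⁻ x in E, a x ^ p * ENNReal.ofReal (v x)) + c ^ p * wMeas v E) ^ (1 / p) := by
        rw [ENNReal.mul_rpow_of_nonneg _ _ hp', ← ENNReal.rpow_mul, mul_one_div_cancel hp.ne',
          ENNReal.rpow_one]
    _ ≤ 2 * (2 ^ (1 / p) * ((∫⁻ x in E, a x ^ p * ENNReal.ofReal (v x)) ^ (1 / p) +
          (c ^ p * wMeas v E) ^ (1 / p))) := by
        gcongr
        exact rpow_add_le_two_rpow_mul _ _ hp'
    _ = _ := by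
        rw [ENNReal.mul_rpow_of_nonneg _ _ hp', ← ENNReal.rpow_mul, mul_one_div_cancel hp.ne',
          ENNReal.rpow_one, mul_assoc]

lemma wMeas_mono (ω : Rn n → ℝ) {E F : Set (Rn n)} (h : E ⊆ F) : wMeas ω E ≤ wMeas ω F :=
  lintegral_mono_set h

lemma wWeakLpNormE_le_add_const {p : ℝ} (hp : 0 < p) (v : Rn n → ℝ)
    {E : Set (Rn n)} {g a : Rn n → ℝ≥0∞} {c : ℝ≥0∞} (h : ∀ x ∈ E, g x ≤ a x + c) :
    wWeakLpNormE p v E g ≤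
      2 * 2 ^ (1 / p) * (wWeakLpNormE p v E a + c * wMeas v E ^ (1 / p)) := by
  have hp' : (0 : ℝ) < 1 / p := by positivity
  refine iSup₂_le fun α hα => ?_
  have hα2 : ENNReal.ofReal α = 2 * ENNReal.ofReal (α / 2) := by
    rw [← ENNReal.ofReal_ofNat, ← ENNReal.ofReal_mul (by norm_num)]
    congr 1; ring
  set F := {x ∈ E | ENNReal.ofReal (α / 2) < a x}
  set G := {x ∈ E | ENNReal.ofReal (α / 2) < c}
  have hsub : {x ∈ E | ENNReal.ofReal α < g x} ⊆ F ∪ G := by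
    rintro x ⟨hxE, hx⟩
    by_contra hcon
    simp only [F, G, mem_union, mem_ofPred_eq, hxE, true_and, not_or, not_lt] at hcon
    have : g x ≤ ENNReal.ofReal α := by
      rw [hα2, two_mul]
      exact (h x hxE).trans (add_le_add hcon.1 hcon.2)
    exact absurd hx this.not_gt
  have hF : ENNReal.ofReal (α / 2) * wMeas v F ^ (1 / p) ≤ wWeakLpNormE p v E a :=
    le_iSup₂ (f := fun (β : ℝ) (_ : 0 < β) =>
      ENNReal.ofReal β * wMeas v {x ∈ E | ENNReal.ofReal β < a x} ^ (1 / p)) (α / 2) (by positivity)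
  have hG : ENNReal.ofReal (α / 2) * wMeas v G ^ (1 / p) ≤ c * wMeas v E ^ (1 / p) := by
    by_cases hc : ENNReal.ofReal (α / 2) < c
    · gcongr
      exact wMeas_mono v fun x hx => hx.1
    · have : G = ∅ := by ext x; simp [G, hc]
      simp [this, wMeas, hp]
  calc ENNReal.ofReal α * wMeas v {x ∈ E | ENNReal.ofReal α < g x} ^ (1 / p)
      ≤ ENNReal.ofReal α * (wMeas v F + wMeas v G) ^ (1 / p) := by
        gcongr
        exact (wMeas_mono v hsub).trans (lintegral_union_le _ _ _)
    _ ≤ 2 * ENNReal.ofReal (α / 2) * (2 ^ (1 / p) * (wMeas v F ^ (1 / p) + wMeas v G ^ (1 / p))) := by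
        rw [hα2]
        gcongr
        exact rpow_add_le_two_rpow_mul _ _ hp'.le
    _ = 2 * 2 ^ (1 / p) * (ENNReal.ofReal (α / 2) * wMeas v F ^ (1 / p) +
          ENNReal.ofReal (α / 2) * wMeas v G ^ (1 / p)) := by ring
    _ ≤ _ := by gcongr

lemma IsWeight.aemeasurable {ω : Rn n → ℝ} (hω : IsWeight ω) : AEMeasurable ω volume :=
  hω.1.aestronglyMeasurable.aemeasurable

lemma IsWeight.wMeas_ball_ne_top {ω : Rn n → ℝ} (hω : IsWeight ω) (x : Rn n) (r : ℝ) :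
    wMeas ω (ball x r) ≠ ⊤ := by
  have : IntegrableOn ω (ball x r) :=
    (hω.1.integrableOn_isCompact (isCompact_closedBall x r)).mono_set ball_subset_closedBall
  exact this.lintegral_lt_top.ne

lemma IsWeight.wMeas_ball_ne_zero {ω : Rn n → ℝ} (hω : IsWeight ω) (x : Rn n) {r : ℝ}
    (hr : 0 < r) : wMeas ω (ball x r) ≠ 0 := by
  intro h
  rw [wMeas, lintegral_eq_zero_iff' hω.aemeasurable.ennreal_ofReal.restrict] at h
  have h2 : ∀ᵐ y ∂(volume.restrict (ball x r)), False := by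
    filter_upwards [h, ae_restrict_of_ae hω.2.2] with y hy hy'
    simp only [Pi.zero_apply, ENNReal.ofReal_eq_zero] at hy
    linarith
  have h3 : volume (ball x r) = 0 := by
    simpa [ae_iff] using h2
  exact (measure_ball_pos volume x hr).ne.symm h3

/-- Hölder's inequality on `E` against a weight. -/
lemma setLIntegral_le_wLpNorm_mul_APfactor {q : ℝ} (hq : 1 ≤ q) {ω : Rn n → ℝ} (hω : IsWeight ω)
    {E : Set (Rn n)} (hE0 : volume E ≠ 0) (hEt : volume E ≠ ⊤) {f : Rn n → ℝ}
    (hf : AEMeasurable f volume) :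
    (volume E)⁻¹ * ∫⁻ y in E, ENNReal.ofReal |f y| ≤
      (volume E)⁻¹ ^ (1 / q) * wLpNorm q ω E f * APfactor q ω E := by
  have hpos : ∀ᵐ y ∂(volume.restrict E), 0 < ω y := ae_restrict_of_ae hω.2.2
  have hfm : AEMeasurable (fun y => ENNReal.ofReal |f y|) (volume.restrict E) :=
    (hf.restrict.abs).ennreal_ofReal
  have hωm : AEMeasurable (fun y => ENNReal.ofReal (ω y)) (volume.restrict E) :=
    hω.aemeasurable.restrict.ennreal_ofReal
  rcases hq.eq_or_lt with rfl | hq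
  · simp only [wLpNorm, wLpNormE, APfactor, if_true, div_one, ENNReal.rpow_one]
    rw [mul_assoc]
    gcongr
    set e := essInf (fun y => ENNReal.ofReal (ω y)) (volume.restrict E) with he
    have hle : ∀ᵐ y ∂(volume.restrict E), e ≤ ENNReal.ofReal (ω y) := ae_essInf_le
    rw [← lintegral_mul_const'' _ (show AEMeasurable
      (fun y => ENNReal.ofReal |f y| * ENNReal.ofReal (ω y)) _ from hfm.mul hωm)]
    refine lintegral_mono_ae ?_
    filter_upwards [hpos, hle] with y hy hey
    have hy0 : ENNReal.ofReal (ω y) ≠ 0 := by simpa using hy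
    calc ENNReal.ofReal |f y| = ENNReal.ofReal |f y| * (ENNReal.ofReal (ω y) *
          (ENNReal.ofReal (ω y))⁻¹) := by
          rw [ENNReal.mul_inv_cancel hy0 ENNReal.ofReal_ne_top, mul_one]
      _ ≤ ENNReal.ofReal |f y| * ENNReal.ofReal (ω y) * e⁻¹ := by
          rw [mul_assoc]; gcongr
  · have hq0 : 0 < q := by linarith
    have hq1 : 0 < q - 1 := by linarith
    have hconj : q.HolderConjugate (q / (q - 1)) := Real.HolderConjugate.conjExponent hq
    have hol := ENNReal.lintegral_mul_le_Lp_mul_Lq (volume.restrict E) hconj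
      (f := fun y => ENNReal.ofReal |f y| * ENNReal.ofReal (ω y) ^ (1 / q))
      (g := fun y => ENNReal.ofReal (ω y) ^ (-(1 / q)))
      (hfm.mul (hωm.pow_const _)) (hωm.pow_const _)
    have e1 : ∫⁻ y in E, ENNReal.ofReal |f y| ≤ ∫⁻ y in E,
        ((fun y => ENNReal.ofReal |f y| * ENNReal.ofReal (ω y) ^ (1 / q)) *
          (fun y => ENNReal.ofReal (ω y) ^ (-(1 / q)))) y := by
      refine lintegral_mono_ae ?_
      filter_upwards [hpos] with y hy
      have hy0 : ENNReal.ofReal (ω y) ≠ 0 := by simpa using hy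
      rw [Pi.mul_apply, mul_assoc, ← ENNReal.rpow_add _ _ hy0 ENNReal.ofReal_ne_top]
      simp
    have e2 : ∀ y, (ENNReal.ofReal |f y| * ENNReal.ofReal (ω y) ^ (1 / q)) ^ q =
        ENNReal.ofReal |f y| ^ q * ENNReal.ofReal (ω y) := fun y => by
      rw [ENNReal.mul_rpow_of_nonneg _ _ hq0.le, ← ENNReal.rpow_mul, one_div_mul_cancel hq0.ne',
        ENNReal.rpow_one]
    have e3 : ∀ y, (ENNReal.ofReal (ω y) ^ (-(1 / q))) ^ (q / (q - 1)) =
        ENNReal.ofReal (ω y) ^ (-(1 / (q - 1))) := fun y => by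
      rw [← ENNReal.rpow_mul]
      congr 1
      field_simp
    simp only [e2, e3] at hol
    have hol := e1.trans hol
    have e4 : 1 / (q / (q - 1)) = (q - 1) / q := by rw [one_div_div]
    rw [e4] at hol
    have e5 : (volume E)⁻¹ = (volume E)⁻¹ ^ (1 / q) * (volume E)⁻¹ ^ ((q - 1) / q) := by
      rw [← ENNReal.rpow_add _ _ (by simpa using hEt) (by simpa using hE0),
        show 1 / q + (q - 1) / q = 1 by rw [← add_div, add_sub_cancel, div_self hq0.ne'], ENNReal.rpow_one]
    simp only [wLpNorm, wLpNormE, APfactor, if_neg hq.ne']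
    rw [ENNReal.mul_rpow_of_nonneg _ _ (show 0 ≤ (q - 1) / q by positivity)]
    calc (volume E)⁻¹ * ∫⁻ y in E, ENNReal.ofReal |f y|
        ≤ (volume E)⁻¹ * _ := mul_le_mul_right hol _
      _ = _ := by
          conv_lhs => rw [e5]
          simp only [mul_assoc, mul_left_comm]

lemma IsAinf.exists_isAq {ω : Rn n → ℝ} (h : IsAinf ω) : ∃ q : ℝ, 1 < q ∧ IsAq q ω := by
  rcases h with ⟨C, hC⟩ | h
  · refine ⟨2, by norm_num, C, fun x r hr => ?_⟩
    have hV0 : volume (ball x r) ≠ 0 := (measure_ball_pos volume x hr).ne'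
    have hVt : volume (ball x r) ≠ ⊤ := measure_ball_lt_top.ne
    set V := volume (ball x r)
    set e := essInf (fun y => ENNReal.ofReal (ω y)) (volume.restrict (ball x r)) with he
    have hle : ∀ᵐ y ∂(volume.restrict (ball x r)), e ≤ ENNReal.ofReal (ω y) := ae_essInf_le
    have h1 : ∫⁻ y in ball x r, ENNReal.ofReal (ω y) ^ (-(1 / ((2 : ℝ) - 1))) ≤ e⁻¹ * V := by
      calc _ ≤ ∫⁻ y in ball x r, e⁻¹ := by
            refine lintegral_mono_ae ?_
            filter_upwards [hle] with y hy
            rw [show -(1 / ((2 : ℝ) - 1)) = -1 by norm_num, ENNReal.rpow_neg_one]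
            gcongr
        _ = e⁻¹ * V := by simp [V]
    rw [show (2 : ℝ) - 1 = 1 by norm_num] at h1 ⊢
    rw [ENNReal.rpow_one]
    calc V⁻¹ * wMeas ω (ball x r) * (V⁻¹ * ∫⁻ y in ball x r, ENNReal.ofReal (ω y) ^ (-(1 / (1 : ℝ))))
        ≤ V⁻¹ * (C * V * e) * (V⁻¹ * (e⁻¹ * V)) := by
          gcongr
          exact hC x r hr
      _ = C * (V⁻¹ * V) * (V⁻¹ * V) * (e * e⁻¹) := by ring
      _ ≤ C * 1 * 1 * 1 := by
          gcongr <;> simp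
      _ = C := by simp
  · exact h

/-- For weights in `A_∞`, the geometric mean of the averages is controlled by the average of the
geometric mean. -/
lemma exists_prod_average_rpow_le {ωs : Fin m → Rn n → ℝ} (hw : ∀ i, IsWeight (ωs i))
    (hA : ∀ i, IsAinf (ωs i)) {p : ℝ} {ps : Fin m → ℝ} (hθ : ∀ i, 0 ≤ p / ps i) :
    ∃ C : ℝ≥0, ∀ (x : Rn n) (r : ℝ), 0 < r →
      ∏ i, ((volume (ball x r))⁻¹ * wMeas (ωs i) (ball x r)) ^ (p / ps i) ≤
        C * ((volume (ball x r))⁻¹ * wMeas (nuw p ps ωs) (ball x r)) := by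
  choose q hq C hC using fun i => (hA i).exists_isAq
  refine ⟨∏ i, C i ^ (p / ps i), fun x r hr => ?_⟩
  have hV0 : volume (ball x r) ≠ 0 := (measure_ball_pos volume x hr).ne'
  have hVt : volume (ball x r) ≠ ⊤ := measure_ball_lt_top.ne
  set V := volume (ball x r)
  set μ : Measure (Rn n) := V⁻¹ • volume.restrict (ball x r) with hμ
  have hμ1 : μ univ = 1 := by
    simp only [hμ, Measure.smul_apply, smul_eq_mul, Measure.restrict_apply_univ]
    exact ENNReal.inv_mul_cancel hV0 hVt
  have hac : μ ≪ volume :=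
    Measure.smul_absolutelyContinuous.trans Measure.restrict_le_self.absolutelyContinuous
  have havg (F : Rn n → ℝ≥0∞) : ∫⁻ y, F y ∂μ = V⁻¹ * ∫⁻ y in ball x r, F y := by
    rw [hμ, lintegral_smul_measure, smul_eq_mul]
  set S : ℝ := 1 + ∑ i, p / ps i * (q i - 1) with hS
  have hSpos : 0 < S := by
    have : 0 ≤ ∑ i, p / ps i * (q i - 1) :=
      Finset.sum_nonneg fun i _ => mul_nonneg (hθ i) (by linarith [hq i])
    linarith
  have hωm (i : Fin m) : AEMeasurable (ωs i) μ := (hw i).aemeasurable.mono_ac hac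
  have hνm : AEMeasurable (nuw p ps ωs) μ :=
    Finset.aemeasurable_fun_prod _ fun i _ => (hωm i).pow_const _
  have hol := ENNReal.lintegral_mul_prod_norm_pow_le (μ := μ) (Finset.univ : Finset (Fin m))
    (g := fun y => ENNReal.ofReal (nuw p ps ωs y))
    (f := fun i y => ENNReal.ofReal (ωs i y) ^ (-(1 / (q i - 1))))
    hνm.ennreal_ofReal (fun i _ => (hωm i).ennreal_ofReal.pow_const _) S⁻¹
    (p := fun i => p / ps i * (q i - 1) * S⁻¹)
    (by rw [← Finset.sum_mul, ← one_add_mul, mul_inv_cancel₀ hSpos.ne'])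
    (by positivity)
    (fun i _ => mul_nonneg (mul_nonneg (hθ i) (by linarith [hq i])) (by positivity))
  have hone : ∫⁻ y, ENNReal.ofReal (nuw p ps ωs y) ^ S⁻¹ *
      ∏ i, (ENNReal.ofReal (ωs i y) ^ (-(1 / (q i - 1)))) ^ (p / ps i * (q i - 1) * S⁻¹) ∂μ = 1 := by
    rw [← hμ1, ← lintegral_one]
    refine lintegral_congr_ae ?_
    have hpos : ∀ᵐ y ∂μ, ∀ i, 0 < ωs i y := hac.ae_le (ae_all_iff.2 fun i => (hw i).2.2)
    filter_upwards [hpos] with y hy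
    have hy0 (i : Fin m) : ENNReal.ofReal (ωs i y) ≠ 0 := by simpa using hy i
    rw [nuw, ENNReal.ofReal_prod_of_nonneg fun i _ => Real.rpow_nonneg (hy i).le _,
      ← ENNReal.prod_rpow_of_nonneg (by positivity), ← Finset.prod_mul_distrib]
    refine Finset.prod_eq_one fun i _ => ?_
    rw [← ENNReal.ofReal_rpow_of_pos (hy i), ← ENNReal.rpow_mul, ← ENNReal.rpow_mul,
      ← ENNReal.rpow_add _ _ (hy0 i) ENNReal.ofReal_ne_top]
    have : q i - 1 ≠ 0 := by linarith [hq i]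
    rw [show p / ps i * S⁻¹ + -(1 / (q i - 1)) * (p / ps i * (q i - 1) * S⁻¹) = 0 by
      field_simp; ring, ENNReal.rpow_zero]
  rw [hone] at hol
  simp only [havg] at hol
  set A : Fin m → ℝ≥0∞ := fun i => V⁻¹ * wMeas (ωs i) (ball x r)
  set D : Fin m → ℝ≥0∞ := fun i =>
    (V⁻¹ * ∫⁻ y in ball x r, ENNReal.ofReal (ωs i y) ^ (-(1 / (q i - 1)))) ^ (q i - 1)
  have h1 : 1 ≤ (V⁻¹ * wMeas (nuw p ps ωs) (ball x r)) * ∏ i, D i ^ (p / ps i) := by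
    have h := ENNReal.rpow_le_rpow hol hSpos.le
    rw [ENNReal.one_rpow, ENNReal.mul_rpow_of_nonneg _ _ hSpos.le,
      ← ENNReal.prod_rpow_of_nonneg hSpos.le, ← ENNReal.rpow_mul, inv_mul_cancel₀ hSpos.ne',
      ENNReal.rpow_one] at h
    refine h.trans_eq ?_
    congr 1
    refine Finset.prod_congr rfl fun i _ => ?_
    simp only [D]
    rw [← ENNReal.rpow_mul, ← ENNReal.rpow_mul, mul_assoc, inv_mul_cancel₀ hSpos.ne', mul_one,
      mul_comm (p / ps i)]
  calc ∏ i, A i ^ (p / ps i)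
      ≤ (∏ i, A i ^ (p / ps i)) *
        ((V⁻¹ * wMeas (nuw p ps ωs) (ball x r)) * ∏ i, D i ^ (p / ps i)) :=
        le_mul_of_one_le_right' h1
    _ = (∏ i, (A i * D i) ^ (p / ps i)) * (V⁻¹ * wMeas (nuw p ps ωs) (ball x r)) := by
        simp only [ENNReal.mul_rpow_of_nonneg _ _ (hθ _), Finset.prod_mul_distrib]
        ring
    _ ≤ (∏ i, (C i : ℝ≥0∞) ^ (p / ps i)) * (V⁻¹ * wMeas (nuw p ps ωs) (ball x r)) := by
        gcongr with i
        · exact hθ i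
        · exact hC i x r hr
    _ = _ := by
        rw [ENNReal.ofNNReal_finsetProd]
        simp only [ENNReal.coe_rpow_of_nonneg _ (hθ _)]

lemma exists_prod_average_mul_APfactor_le {ωs : Fin m → Rn n → ℝ} (hw : ∀ i, IsWeight (ωs i))
    (hA : ∀ i, IsAinf (ωs i)) {p : ℝ} {ps : Fin m → ℝ} (hp0 : 0 < p) (hps : ∀ i, 1 ≤ ps i)
    (hAP : IsMultiAP p ps ωs) :
    ∃ C : ℝ≥0, ∀ (x : Rn n) (r : ℝ), 0 < r →
      ∏ i, (((volume (ball x r))⁻¹ * wMeas (ωs i) (ball x r)) ^ (1 / ps i) *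
        APfactor (ps i) (ωs i) (ball x r)) ≤ C := by
  have hpi (i : Fin m) : 0 < ps i := by linarith [hps i]
  obtain ⟨C₁, hC₁⟩ := exists_prod_average_rpow_le hw hA (p := p) (ps := ps)
    (fun i => (div_pos hp0 (hpi i)).le)
  obtain ⟨C₂, hC₂⟩ := hAP
  have hp' : 0 ≤ 1 / p := by positivity
  refine ⟨C₁ ^ (1 / p) * C₂, fun x r hr => ?_⟩
  have h := ENNReal.rpow_le_rpow (hC₁ x r hr) hp'
  rw [← ENNReal.prod_rpow_of_nonneg hp', ENNReal.mul_rpow_of_nonneg _ _ hp'] at h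
  have e (i : Fin m) : p / ps i * (1 / p) = 1 / ps i := by field_simp
  simp only [← ENNReal.rpow_mul, e] at h
  rw [Finset.prod_mul_distrib, ENNReal.coe_mul, ENNReal.coe_rpow_of_nonneg _ hp']
  calc _ ≤ (C₁ : ℝ≥0∞) ^ (1 / p) *
          ((volume (ball x r))⁻¹ * wMeas (nuw p ps ωs) (ball x r)) ^ (1 / p) *
          ∏ i, APfactor (ps i) (ωs i) (ball x r) := by gcongr
    _ ≤ _ := by
        rw [mul_assoc]
        gcongr
        exact hC₂ x r hr

/-- The product of averages of the `fᵢ` over a ball is controlled by the product of the weighted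
`L^{pᵢ}` averages. -/
lemma exists_prod_average_le {ωs : Fin m → Rn n → ℝ} (hw : ∀ i, IsWeight (ωs i))
    (hA : ∀ i, IsAinf (ωs i)) {p : ℝ} {ps : Fin m → ℝ} (hp0 : 0 < p) (hps : ∀ i, 1 ≤ ps i)
    (hAP : IsMultiAP p ps ωs) :
    ∃ C : ℝ≥0, ∀ (x : Rn n) (r : ℝ), 0 < r → ∀ f : Fin m → Rn n → ℝ,
      (∀ i, AEMeasurable (f i) volume) →
      ∏ i, ((volume (ball x r))⁻¹ * ∫⁻ y in ball x r, ENNReal.ofReal |f i y|) ≤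
        C * ((∏ i, wLpNorm (ps i) (ωs i) (ball x r) (f i)) *
          (∏ i, wMeas (ωs i) (ball x r) ^ (1 / ps i))⁻¹) := by
  obtain ⟨C, hC⟩ := exists_prod_average_mul_APfactor_le hw hA hp0 hps hAP
  refine ⟨C, fun x r hr f hf => ?_⟩
  have hV0 : volume (ball x r) ≠ 0 := (measure_ball_pos volume x hr).ne'
  have hVt : volume (ball x r) ≠ ⊤ := measure_ball_lt_top.ne
  have hpi (i : Fin m) : 0 < ps i := by linarith [hps i]
  set V := volume (ball x r)
  set W : Fin m → ℝ≥0∞ := fun i => wMeas (ωs i) (ball x r) ^ (1 / ps i)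
  have hW0 (i : Fin m) : W i ≠ 0 := by
    simp [W, (hw i).wMeas_ball_ne_zero x hr, (hw i).wMeas_ball_ne_top x r]
  have hWt (i : Fin m) : W i ≠ ⊤ :=
    ENNReal.rpow_ne_top_of_nonneg (by have := hpi i; positivity) ((hw i).wMeas_ball_ne_top x r)
  calc ∏ i, (V⁻¹ * ∫⁻ y in ball x r, ENNReal.ofReal |f i y|)
      ≤ ∏ i, (V⁻¹ ^ (1 / ps i) * wLpNorm (ps i) (ωs i) (ball x r) (f i) *
          APfactor (ps i) (ωs i) (ball x r)) :=
        Finset.prod_le_prod' fun i _ =>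
          setLIntegral_le_wLpNorm_mul_APfactor (hps i) (hw i) hV0 hVt (hf i)
    _ = ∏ i, (((V⁻¹ * wMeas (ωs i) (ball x r)) ^ (1 / ps i) *
          APfactor (ps i) (ωs i) (ball x r)) *
          (wLpNorm (ps i) (ωs i) (ball x r) (f i) * (W i)⁻¹)) := by
        refine Finset.prod_congr rfl fun i _ => ?_
        have h1 : V⁻¹ ^ (1 / ps i) =
            (V⁻¹ * wMeas (ωs i) (ball x r)) ^ (1 / ps i) * (W i)⁻¹ := by
          rw [ENNReal.mul_rpow_of_nonneg _ _ (by have := hpi i; positivity)]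
          exact (ENNReal.mul_inv_cancel_right (hW0 i) (hWt i)).symm
        rw [h1]
        ring
    _ ≤ _ := by
        rw [Finset.prod_mul_distrib, Finset.prod_mul_distrib (f := fun i => wLpNorm _ _ _ _),
          ENNReal.prod_inv_distrib fun i _ j _ _ => Or.inl (hW0 i)]
        gcongr
        exact hC x r hr

lemma lintegral_fin_prod_eq_prod {X : Type*} [MeasurableSpace X] (μ : Measure X) [SigmaFinite μ] :
    ∀ {k : ℕ} (f : Fin k → X → ℝ≥0∞), (∀ i, AEMeasurable (f i) μ) →
      ∫⁻ y, ∏ i, f i (y i) ∂(Measure.pi fun _ : Fin k => μ) = ∏ i, ∫⁻ x, f i x ∂μ := by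
  intro k
  induction k with
  | zero => intro f _; simp
  | succ k ih =>
    intro f hf
    have hmp := (measurePreserving_piFinSuccAbove (fun _ : Fin (k + 1) => μ) 0).symm
    rw [← hmp.lintegral_comp_emb (MeasurableEquiv.measurableEmbedding _)]
    have hrest : AEMeasurable (fun z : Fin k → X => ∏ i, f i.succ (z i))
        (Measure.pi fun _ : Fin k => μ) :=
      Finset.aemeasurable_fun_prod _ fun i _ =>
        (hf i.succ).comp_quasiMeasurePreserving (Measure.quasiMeasurePreserving_eval _ i)
    rw [Fin.prod_univ_succ, ← ih (fun i => f i.succ) fun i => hf i.succ,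
      ← lintegral_prod_mul (hf 0) hrest]
    refine lintegral_congr fun z => ?_
    simp [Fin.prod_univ_succ, MeasurableEquiv.piFinSuccAbove_symm_apply, Fin.insertNthEquiv]

lemma inv_pow_le_of_le_mul {S M c : ℝ} (hS : 0 < S) (hM : 0 < M) (h : M ≤ c * S) (d : ℕ) :
    (S ^ d)⁻¹ ≤ 2 * (2 * c) ^ d * (((2 * M) ^ d)⁻¹ * (2 * M)⁻¹ * M) := by
  have h1 : (2 * M) ^ d ≤ (2 * c) ^ d * S ^ d := by
    rw [← mul_pow]
    exact pow_le_pow_left₀ (by positivity) (by linarith) d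
  have h2 : (2 * M)⁻¹ * M = 1 / 2 := by
    rw [mul_inv, mul_assoc, inv_mul_cancel₀ hM.ne', mul_one, one_div]
  have h3 : 2 * (2 * c) ^ d * (((2 * M) ^ d)⁻¹ * (2 * M)⁻¹ * M) =
      (2 * c) ^ d * ((2 * M) ^ d)⁻¹ := by
    rw [mul_assoc ((2 * M) ^ d)⁻¹, h2]
    ring
  rw [h3, ← div_eq_mul_inv, le_div_iff₀ (by positivity), inv_mul_le_iff₀ (by positivity),
    mul_comm (S ^ d)]
  exact h1

lemma inv_pow_sum_dist_le {x₀ x : Rn n} {r : ℝ} (hr : 0 < r) (hx : x ∈ ball x₀ r)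
    {y : Fin m → Rn n} {k : Fin m} (hk : 2 * r ≤ dist (y k) x₀) (d : ℕ) :
    0 < ∑ j, dist x (y j) ∧ 2 * r ≤ ∑ j, dist (y j) x₀ ∧
      ((∑ j, dist x (y j)) ^ d)⁻¹ ≤ 2 * (2 * (m + 1)) ^ d *
        (((2 * ∑ j, dist (y j) x₀) ^ d)⁻¹ * (2 * ∑ j, dist (y j) x₀)⁻¹ * ∑ j, dist (y j) x₀) := by
  have hxk : r ≤ dist x (y k) := by
    have h1 := dist_triangle (y k) x x₀
    have h2 : dist x x₀ < r := hx
    rw [dist_comm (y k) x] at h1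
    linarith
  have hSk : dist x (y k) ≤ ∑ j, dist x (y j) :=
    Finset.single_le_sum (f := fun j => dist x (y j)) (fun _ _ => dist_nonneg) (Finset.mem_univ k)
  have hMk : dist (y k) x₀ ≤ ∑ j, dist (y j) x₀ :=
    Finset.single_le_sum (f := fun j => dist (y j) x₀) (fun _ _ => dist_nonneg) (Finset.mem_univ k)
  have hMS : ∑ j, dist (y j) x₀ ≤ (m + 1) * ∑ j, dist x (y j) := by
    calc ∑ j, dist (y j) x₀ ≤ ∑ j, (dist x (y j) + r) := by
          refine Finset.sum_le_sum fun j _ => ?_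
          have h1 := dist_triangle (y j) x x₀
          have h2 : dist x x₀ < r := hx
          rw [dist_comm (y j) x] at h1
          linarith
      _ = ∑ j, dist x (y j) + m * r := by simp [Finset.sum_add_distrib]
      _ ≤ ∑ j, dist x (y j) + m * ∑ j, dist x (y j) := by gcongr; linarith
      _ = _ := by ring
  have hS : 0 < ∑ j, dist x (y j) := by linarith
  exact ⟨hS, by linarith, inv_pow_le_of_le_mul hS (by linarith) hMS d⟩

/-- Pointwise domination of the size kernel by a superposition of products of balls. -/
lemma prod_mul_kernel_le {x₀ x : Rn n} {r : ℝ} (hr : 0 < r) (hx : x ∈ ball x₀ r)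
    {h : Fin m → Rn n → ℝ} {k : Fin m} (hk : ∀ z ∈ ball x₀ (2 * r), h k z = 0)
    (y : Fin m → Rn n) :
    (∏ i, ENNReal.ofReal |h i (y i)|) * ENNReal.ofReal (∑ j, dist x (y j)) ^ (-(m * n : ℝ)) ≤
      ENNReal.ofReal (2 * (2 * (m + 1)) ^ (m * n)) * ∫⁻ t in Ioi r,
        (∏ i, (ball x₀ t).indicator (fun z => ENNReal.ofReal |h i z|) (y i)) *
          ((ENNReal.ofReal t ^ (m * n))⁻¹ * (ENNReal.ofReal t)⁻¹) := by
  by_cases hyk : y k ∈ ball x₀ (2 * r)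
  · rw [Finset.prod_eq_zero (Finset.mem_univ k) (by simp [hk _ hyk]), zero_mul]
    exact zero_le
  obtain ⟨hS, hM2, hle⟩ := inv_pow_sum_dist_le hr hx (k := k) (by simpa using hyk) (m * n)
  have hsingle (j : Fin m) : dist (y j) x₀ ≤ ∑ j, dist (y j) x₀ :=
    Finset.single_le_sum (f := fun j => dist (y j) x₀) (fun _ _ => dist_nonneg) (Finset.mem_univ j)
  set S := ∑ j, dist x (y j)
  set M := ∑ j, dist (y j) x₀
  have hM : 0 < M := by linarith
  have hSpow : ENNReal.ofReal S ^ (-(m * n : ℝ)) = ENNReal.ofReal ((S ^ (m * n))⁻¹) := by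
    rw [ENNReal.rpow_neg, ENNReal.ofReal_inv_of_pos (by positivity), ENNReal.ofReal_pow hS.le,
      ← Nat.cast_mul, ENNReal.rpow_natCast]
  have hlow : (∏ i, ENNReal.ofReal |h i (y i)|) *
      ENNReal.ofReal (((2 * M) ^ (m * n))⁻¹ * (2 * M)⁻¹ * M) ≤
      ∫⁻ t in Ioi r,
        (∏ i, (ball x₀ t).indicator (fun z => ENNReal.ofReal |h i z|) (y i)) *
          ((ENNReal.ofReal t ^ (m * n))⁻¹ * (ENNReal.ofReal t)⁻¹) := by
    calc _ = ∫⁻ t in Ioc M (2 * M), (∏ i, ENNReal.ofReal |h i (y i)|) *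
          ((ENNReal.ofReal (2 * M) ^ (m * n))⁻¹ * (ENNReal.ofReal (2 * M))⁻¹) := by
          rw [setLIntegral_const, Real.volume_Ioc, show 2 * M - M = M by ring,
            ENNReal.ofReal_mul (by positivity), ENNReal.ofReal_mul (by positivity),
            ENNReal.ofReal_inv_of_pos (by positivity), ENNReal.ofReal_inv_of_pos (by positivity),
            ENNReal.ofReal_pow (by positivity)]
          simp only [mul_assoc]
      _ ≤ ∫⁻ t in Ioc M (2 * M),
          (∏ i, (ball x₀ t).indicator (fun z => ENNReal.ofReal |h i z|) (y i)) *
          ((ENNReal.ofReal t ^ (m * n))⁻¹ * (ENNReal.ofReal t)⁻¹) := by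
          refine setLIntegral_mono_ae' measurableSet_Ioc (ae_of_all _ fun t ht => ?_)
          have hmem (i : Fin m) : y i ∈ ball x₀ t := lt_of_le_of_lt (hsingle i) ht.1
          simp only [indicator_of_mem (hmem _)]
          have := ht.2
          gcongr
      _ ≤ _ := lintegral_mono_set fun t ht => lt_trans (by linarith) ht.1
  calc _ ≤ (∏ i, ENNReal.ofReal |h i (y i)|) * (ENNReal.ofReal (2 * (2 * (m + 1)) ^ (m * n)) *
        ENNReal.ofReal (((2 * M) ^ (m * n))⁻¹ * (2 * M)⁻¹ * M)) := by
        rw [hSpow, ← ENNReal.ofReal_mul (by positivity)]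
        gcongr
    _ = ENNReal.ofReal (2 * (2 * (m + 1)) ^ (m * n)) * ((∏ i, ENNReal.ofReal |h i (y i)|) *
        ENNReal.ofReal (((2 * M) ^ (m * n))⁻¹ * (2 * M)⁻¹ * M)) := by ring
    _ ≤ _ := by gcongr

lemma exists_lintegral_kernel_le (n m : ℕ) : ∃ K : ℝ≥0, ∀ (x₀ : Rn n) (r : ℝ), 0 < r →
    ∀ x ∈ ball x₀ r, ∀ h : Fin m → Rn n → ℝ, (∀ i, AEMeasurable (h i) volume) →
    (∃ k, ∀ z ∈ ball x₀ (2 * r), h k z = 0) →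
    ∫⁻ y : Fin m → Rn n, (∏ i, ENNReal.ofReal |h i (y i)|) *
        ENNReal.ofReal (∑ j, dist x (y j)) ^ (-(m * n : ℝ)) ≤
      K * ∫⁻ t in Ioi r, (∏ i, ((volume (ball x₀ t))⁻¹ *
        ∫⁻ z in ball x₀ t, ENNReal.ofReal |h i z|)) * (ENNReal.ofReal t)⁻¹ := by
  set V₁ : ℝ≥0∞ := volume (ball (0 : Rn n) 1) with hV₁
  have hV0 : V₁ ≠ 0 := (measure_ball_pos volume _ one_pos).ne'
  have hVt : V₁ ≠ ⊤ := measure_ball_lt_top.ne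
  have hK : ENNReal.ofReal (2 * (2 * (m + 1)) ^ (m * n)) * V₁ ^ m ≠ ⊤ :=
    ENNReal.mul_ne_top ENNReal.ofReal_ne_top (ENNReal.pow_ne_top hVt)
  refine ⟨(ENNReal.ofReal (2 * (2 * (m + 1)) ^ (m * n)) * V₁ ^ m).toNNReal,
    fun x₀ r hr x hx h hh ⟨k, hk⟩ => ?_⟩
  rw [ENNReal.coe_toNNReal hK]
  have hhm (i : Fin m) : AEMeasurable (fun z => ENNReal.ofReal |h i z|) volume :=
    (hh i).abs.ennreal_ofReal
  have hmeas : AEMeasurable (uncurry fun (y : Fin m → Rn n) (t : ℝ) =>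
      (∏ i, (ball x₀ t).indicator (fun z => ENNReal.ofReal |h i z|) (y i)) *
        ((ENNReal.ofReal t ^ (m * n))⁻¹ * (ENNReal.ofReal t)⁻¹))
      ((volume : Measure (Fin m → Rn n)).prod (volume.restrict (Ioi r))) := by
    refine AEMeasurable.mul (Finset.aemeasurable_fun_prod _ fun i _ => ?_)
      (by fun_prop)
    have hset : MeasurableSet {q : (Fin m → Rn n) × ℝ | dist (q.1 i) x₀ < q.2} :=
      measurableSet_lt (by fun_prop) (by fun_prop)
    exact ((hhm i).comp_quasiMeasurePreserving
      ((Measure.quasiMeasurePreserving_eval (fun _ : Fin m => (volume : Measure (Rn n))) i).comp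
        Measure.quasiMeasurePreserving_fst)).indicator hset
  calc _ ≤ ∫⁻ y : Fin m → Rn n, ENNReal.ofReal (2 * (2 * (m + 1)) ^ (m * n)) * ∫⁻ t in Ioi r,
        (∏ i, (ball x₀ t).indicator (fun z => ENNReal.ofReal |h i z|) (y i)) *
          ((ENNReal.ofReal t ^ (m * n))⁻¹ * (ENNReal.ofReal t)⁻¹) :=
        lintegral_mono fun y => prod_mul_kernel_le hr hx hk y
    _ = ENNReal.ofReal (2 * (2 * (m + 1)) ^ (m * n)) * ∫⁻ t in Ioi r, ∫⁻ y : Fin m → Rn n,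
        (∏ i, (ball x₀ t).indicator (fun z => ENNReal.ofReal |h i z|) (y i)) *
          ((ENNReal.ofReal t ^ (m * n))⁻¹ * (ENNReal.ofReal t)⁻¹) := by
        rw [lintegral_const_mul' _ _ ENNReal.ofReal_ne_top, lintegral_lintegral_swap hmeas]
    _ = ENNReal.ofReal (2 * (2 * (m + 1)) ^ (m * n)) * ∫⁻ t in Ioi r, V₁ ^ m *
        ((∏ i, ((volume (ball x₀ t))⁻¹ * ∫⁻ z in ball x₀ t, ENNReal.ofReal |h i z|)) *
          (ENNReal.ofReal t)⁻¹) := by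
        congr 1
        refine setLIntegral_congr_fun measurableSet_Ioi fun t ht => ?_
        have ht0 : 0 < t := lt_trans hr ht
        have ht0' : ENNReal.ofReal t ≠ 0 := by simpa using ht0
        have hvol : volume (ball x₀ t) = ENNReal.ofReal t ^ n * V₁ := by
          rw [Measure.addHaar_ball_of_pos _ _ ht0, ENNReal.ofReal_pow ht0.le]
          simp [hV₁]
        have hc : (ENNReal.ofReal t ^ (m * n))⁻¹ * (ENNReal.ofReal t)⁻¹ ≠ ⊤ :=
          ENNReal.mul_ne_top (by simp [ht0']) (by simp [ht0])
        have hpi := lintegral_fin_prod_eq_prod (volume : Measure (Rn n))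
          (fun i => (ball x₀ t).indicator fun z => ENNReal.ofReal |h i z|)
          fun i => (hhm i).indicator measurableSet_ball
        rw [lintegral_mul_const' _ _ hc]
        refine (congrArg (· * _) hpi).trans ?_
        simp only [lintegral_indicator measurableSet_ball, Finset.prod_mul_distrib,
          Finset.prod_const, Finset.card_univ, Fintype.card_fin, hvol]
        rw [ENNReal.mul_inv (Or.inr hVt) (Or.inr hV0), mul_pow, mul_comm m n, pow_mul,
          ENNReal.inv_pow (a := ENNReal.ofReal t ^ n)]
        have hcan : V₁ ^ m * V₁⁻¹ ^ m = 1 := by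
          rw [← mul_pow, ENNReal.mul_inv_cancel hV0 hVt, one_pow]
        calc _ = (V₁ ^ m * V₁⁻¹ ^ m) *
              ((∏ i, ∫⁻ z in ball x₀ t, ENNReal.ofReal |h i z|) *
              ((ENNReal.ofReal t ^ n)⁻¹ ^ m * (ENNReal.ofReal t)⁻¹)) := by rw [hcan, one_mul]
          _ = _ := by ring
    _ = _ := by
        rw [lintegral_const_mul' _ _ (ENNReal.pow_ne_top hVt), mul_assoc]

lemma wLpNormE_mono {p : ℝ} (hp : 0 ≤ p) (ω : Rn n → ℝ) {E F : Set (Rn n)} (hEF : E ⊆ F)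
    {f g : Rn n → ℝ≥0∞} (hfg : ∀ x, f x ≤ g x) : wLpNormE p ω E f ≤ wLpNormE p ω F g := by
  refine ENNReal.rpow_le_rpow ?_ (by positivity)
  refine (lintegral_mono fun x => ?_).trans (lintegral_mono_set hEF)
  gcongr
  exact hfg x

lemma wLpNorm_mono {p : ℝ} (hp : 0 ≤ p) (ω : Rn n → ℝ) {E F : Set (Rn n)} (hEF : E ⊆ F)
    {f g : Rn n → ℝ} (hfg : ∀ x, |f x| ≤ |g x|) : wLpNorm p ω E f ≤ wLpNorm p ω F g :=
  wLpNormE_mono hp ω hEF fun x => ENNReal.ofReal_le_ofReal (hfg x)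

lemma morreyNorm_mono {p : ℝ} (hp : 0 ≤ p) (φ : Rn n → ℝ → ℝ) (ω : Rn n → ℝ)
    {f g : Rn n → ℝ} (hfg : ∀ x, |f x| ≤ |g x|) : morreyNorm p φ ω f ≤ morreyNorm p φ ω g := by
  refine iSup_mono fun x => iSup_mono fun r => iSup_mono fun _ => ?_
  gcongr
  exact wLpNorm_mono hp ω Subset.rfl hfg

lemma abs_indicator_le (s : Set (Rn n)) (f : Rn n → ℝ) (x : Rn n) : |s.indicator f x| ≤ |f x| := by
  by_cases h : x ∈ s <;> simp [h]

lemma MemMorrey.indicator {p : ℝ} (hp : 0 ≤ p) {φ : Rn n → ℝ → ℝ} {ω f : Rn n → ℝ}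
    (hf : MemMorrey p φ ω f) {s : Set (Rn n)} (hs : MeasurableSet s) :
    MemMorrey p φ ω (s.indicator f) :=
  ⟨fun x => (hf.1 x).imp fun _ h => ⟨h.1, h.2.indicator hs⟩,
    (morreyNorm_mono hp φ ω (abs_indicator_le s f)).trans_lt hf.2⟩

lemma wLpNorm_ball_le_morreyNorm {q : ℝ} {φ : Rn n → ℝ → ℝ} {ω f : Rn n → ℝ} (hω : IsWeight ω)
    (hf : morreyNorm q φ ω f < ⊤) (x : Rn n) {r : ℝ} (hr : 0 < r) :
    wLpNorm q ω (ball x r) f ≤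
      ENNReal.ofReal (φ x r) * wMeas ω (ball x r) ^ (1 / q) * morreyNorm q φ ω f := by
  set a := ENNReal.ofReal (φ x r)
  set w := wMeas ω (ball x r)
  set N := wLpNorm q ω (ball x r) f with hN
  have hw0 : w ≠ 0 := hω.wMeas_ball_ne_zero x hr
  have hwt : w ≠ ⊤ := hω.wMeas_ball_ne_top x r
  have hle : a⁻¹ * w ^ (-(1 / q)) * N ≤ morreyNorm q φ ω f :=
    le_iSup_of_le x (le_iSup_of_le r (le_iSup_of_le hr le_rfl))
  have hwq0 : w ^ (1 / q) ≠ 0 := by simp [ENNReal.rpow_eq_zero_iff, hw0, hwt]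
  have hwqt : w ^ (1 / q) ≠ ⊤ := by simp [ENNReal.rpow_eq_top_iff, hw0, hwt]
  rw [ENNReal.rpow_neg] at hle
  have key : a * w ^ (1 / q) * (a⁻¹ * (w ^ (1 / q))⁻¹ * N) ≤
      a * w ^ (1 / q) * morreyNorm q φ ω f := by gcongr
  rcases eq_or_ne a 0 with ha | ha
  · have hN0 : N = 0 := by
      by_contra hN0
      rw [ha, ENNReal.inv_zero, ENNReal.top_mul (by simpa using hwqt), ENNReal.top_mul hN0] at hle
      exact absurd hf (not_lt.2 hle)
    rw [hN0]
    exact zero_le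
  · calc N = (a * a⁻¹) * (w ^ (1 / q) * (w ^ (1 / q))⁻¹) * N := by
          rw [ENNReal.mul_inv_cancel ha ENNReal.ofReal_ne_top, ENNReal.mul_inv_cancel hwq0 hwqt,
            one_mul, one_mul]
      _ = a * w ^ (1 / q) * (a⁻¹ * (w ^ (1 / q))⁻¹ * N) := by ring
      _ ≤ _ := key

lemma prod_wLpNorm_le_essInfProd {ps : Fin m → ℝ} (hps : ∀ i, 1 ≤ ps i)
    {φ1 : Fin m → Rn n → ℝ → ℝ} {ωs : Fin m → Rn n → ℝ} (hw : ∀ i, IsWeight (ωs i))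
    {f : Fin m → Rn n → ℝ} (hf : ∀ i, morreyNorm (ps i) (φ1 i) (ωs i) (f i) < ⊤)
    (x : Rn n) {t : ℝ} (ht : 0 < t) :
    ∏ i, wLpNorm (ps i) (ωs i) (ball x t) (f i) ≤
      essInfProd ps φ1 ωs x t * ∏ i, morreyNorm (ps i) (φ1 i) (ωs i) (f i) := by
  set M := ∏ i, morreyNorm (ps i) (φ1 i) (ωs i) (f i) with hM
  have hMt : M ≠ ⊤ := (ENNReal.prod_lt_top fun i _ => hf i).ne
  have hle (η : ℝ) (hη : t < η) : ∏ i, wLpNorm (ps i) (ωs i) (ball x t) (f i) ≤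
      (∏ i, ENNReal.ofReal (φ1 i x η) * wMeas (ωs i) (ball x η) ^ (1 / ps i)) * M := by
    rw [hM, ← Finset.prod_mul_distrib]
    refine Finset.prod_le_prod' fun i _ => ?_
    exact (wLpNorm_mono (zero_le_one.trans (hps i)) _ (ball_subset_ball hη.le) fun _ => le_rfl).trans
      (wLpNorm_ball_le_morreyNorm (hw i) (hf i) x (ht.trans hη))
  rcases eq_or_ne M 0 with hM0 | hM0
  · simpa [hM0] using hle (t + 1) (by linarith)
  · rw [← ENNReal.div_le_iff hM0 hMt]
    refine le_essInf_of_ae_le _ ((ae_restrict_iff' measurableSet_Ioi).2 (ae_of_all _ fun η hη => ?_))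
    exact (ENNReal.div_le_iff hM0 hMt).2 (hle η hη)

/-- The bound for `T h` on a ball whose double carries no mass of one of the entries of `h`. -/
lemma exists_le_of_pointwiseSize {p : ℝ} (hp0 : 0 < p) {ps : Fin m → ℝ} (hps : ∀ i, 1 ≤ ps i)
    {ωs : Fin m → Rn n → ℝ} (hw : ∀ i, IsWeight (ωs i)) (hA : ∀ i, IsAinf (ωs i))
    (hAP : IsMultiAP p ps ωs) {φ1 : Fin m → Rn n → ℝ → ℝ} {φ2 : Rn n → ℝ → ℝ}
    (hcond : phiCond 0 ps φ1 ωs φ2) {T : (Fin m → Rn n → ℝ) → Rn n → ℝ}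
    (hsize : PointwiseSize T fun i f => MemMorrey (ps i) (φ1 i) (ωs i) f) :
    ∃ C : ℝ≥0, ∀ (x₀ : Rn n) (r : ℝ), 0 < r → ∀ f : Fin m → Rn n → ℝ,
      (∀ i, MemMorrey (ps i) (φ1 i) (ωs i) (f i)) → ∃ D : ℝ≥0∞,
      (ENNReal.ofReal (φ2 x₀ r))⁻¹ * D ≤ C * ∏ i, morreyNorm (ps i) (φ1 i) (ωs i) (f i) ∧
      ∀ h : Fin m → Rn n → ℝ, (∀ i, MemMorrey (ps i) (φ1 i) (ωs i) (h i)) →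
      (∀ i x, |h i x| ≤ |f i x|) → (∃ k, ∀ z ∈ ball x₀ (2 * r), h k z = 0) →
      ∀ x ∈ ball x₀ r, ENNReal.ofReal |T h x| ≤ D := by
  obtain ⟨C₁, hC₁⟩ := hsize
  obtain ⟨C₂, hC₂⟩ := exists_lintegral_kernel_le n m
  obtain ⟨C₃, hC₃⟩ := exists_prod_average_le hw hA hp0 hps hAP
  set Kφ := ⨆ (x : Rn n) (r : ℝ) (_ : 0 < r), phiCondAt 0 ps φ1 ωs φ2 x r with hKφ
  refine ⟨C₁ * C₂ * C₃ * Kφ.toNNReal, fun x₀ r hr f hf => ?_⟩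
  set M := ∏ i, morreyNorm (ps i) (φ1 i) (ωs i) (f i) with hM
  have hMt : M ≠ ⊤ := (ENNReal.prod_lt_top fun i _ => (hf i).2).ne
  set I := ∫⁻ t in Ioi r, essInfProd ps φ1 ωs x₀ t *
    (∏ i, wMeas (ωs i) (ball x₀ t) ^ (1 / ps i))⁻¹ * (ENNReal.ofReal t)⁻¹ with hI
  refine ⟨C₁ * C₂ * C₃ * (I * M), ?_, fun h hh hhf hk x hx => ?_⟩
  · have hphi : (ENNReal.ofReal (φ2 x₀ r))⁻¹ * I ≤ Kφ := by
      have : phiCondAt 0 ps φ1 ωs φ2 x₀ r ≤ Kφ :=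
        le_iSup_of_le x₀ (le_iSup_of_le r (le_iSup_of_le hr le_rfl))
      simpa only [phiCondAt, pow_zero, one_mul] using this
    calc (ENNReal.ofReal (φ2 x₀ r))⁻¹ * (C₁ * C₂ * C₃ * (I * M))
        = C₁ * C₂ * C₃ * ((ENNReal.ofReal (φ2 x₀ r))⁻¹ * I) * M := by ring
      _ ≤ C₁ * C₂ * C₃ * Kφ * M := by gcongr
      _ = _ := by
        push_cast
        rw [ENNReal.coe_toNNReal (ne_of_lt hcond)]
  · have hxs : x ∉ ⋂ j, Function.support (h j) := by
      obtain ⟨k, hk⟩ := hk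
      have : h k x = 0 := hk x (ball_subset_ball (by linarith) hx)
      simp only [mem_iInter, Function.mem_support, not_forall, not_not]
      exact ⟨k, this⟩
    have hmeas (i : Fin m) : AEMeasurable (h i) volume := (hh i).1.aestronglyMeasurable.aemeasurable
    calc ENNReal.ofReal |T h x| ≤ _ := hC₁ h hh x hxs
      _ ≤ C₁ * (C₂ * ∫⁻ t in Ioi r, (∏ i, ((volume (ball x₀ t))⁻¹ *
          ∫⁻ z in ball x₀ t, ENNReal.ofReal |h i z|)) * (ENNReal.ofReal t)⁻¹) := by
        gcongr
        exact hC₂ x₀ r hr x hx h hmeas hk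
      _ ≤ C₁ * (C₂ * ∫⁻ t in Ioi r, C₃ * ((essInfProd ps φ1 ωs x₀ t *
          (∏ i, wMeas (ωs i) (ball x₀ t) ^ (1 / ps i))⁻¹ * (ENNReal.ofReal t)⁻¹) * M)) := by
        refine mul_le_mul_right (mul_le_mul_right ?_ _) _
        refine setLIntegral_mono_ae' measurableSet_Ioi (ae_of_all _ fun t ht => ?_)
        have ht0 : 0 < t := hr.trans ht
        calc _ ≤ C₃ * ((∏ i, wLpNorm (ps i) (ωs i) (ball x₀ t) (h i)) *
              (∏ i, wMeas (ωs i) (ball x₀ t) ^ (1 / ps i))⁻¹) * (ENNReal.ofReal t)⁻¹ := by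
              gcongr
              exact hC₃ x₀ t ht0 h hmeas
          _ ≤ C₃ * ((essInfProd ps φ1 ωs x₀ t * M) *
              (∏ i, wMeas (ωs i) (ball x₀ t) ^ (1 / ps i))⁻¹) * (ENNReal.ofReal t)⁻¹ := by
              gcongr
              refine le_trans (Finset.prod_le_prod' fun i _ => ?_)
                (prod_wLpNorm_le_essInfProd hps hw (fun i => (hf i).2) x₀ ht0)
              exact wLpNorm_mono (zero_le_one.trans (hps i)) _ Subset.rfl (hhf i)
          _ = _ := by ring
      _ = _ := by
        rw [lintegral_const_mul' _ _ ENNReal.coe_ne_top, lintegral_mul_const' _ _ hMt]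
        ring

/-- Replacing the entries of an `m`-sublinear operator one by one by their localizations. -/
lemma ofReal_abs_le_loc0_add {T : (Fin m → Rn n → ℝ) → Rn n → ℝ} (hsub : MSublinear T)
    {x₀ x : Rn n} {r : ℝ} {f : Fin m → Rn n → ℝ} {D : ℝ≥0∞}
    (hD : ∀ (S : Finset (Fin m)) (i : Fin m), ENNReal.ofReal |T (update
      (fun j => if j ∈ S then loc0 x₀ r (f j) else f j) i (locInf x₀ r (f i))) x| ≤ D) :
    ENNReal.ofReal |T f x| ≤ ENNReal.ofReal |T (fun i => loc0 x₀ r (f i)) x| + m * D := by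
  have key (S : Finset (Fin m)) : ENNReal.ofReal |T f x| ≤
      ENNReal.ofReal |T (fun j => if j ∈ S then loc0 x₀ r (f j) else f j) x| + S.card * D := by
    induction S using Finset.induction_on with
    | empty => simp
    | insert i S hi ih =>
      set F : Fin m → Rn n → ℝ := fun j => if j ∈ S then loc0 x₀ r (f j) else f j with hF
      have h1 : update F i (loc0 x₀ r (f i) + locInf x₀ r (f i)) = F := by
        rw [loc0, locInf, indicator_self_add_compl, update_eq_self_iff]
        simp [hF, hi]
      have h2 : update F i (loc0 x₀ r (f i)) =
          fun j => if j ∈ insert i S then loc0 x₀ r (f j) else f j := by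
        funext j
        rcases eq_or_ne j i with rfl | hj <;> simp [*]
      have h3 := hsub F i (loc0 x₀ r (f i)) (locInf x₀ r (f i)) x
      rw [h1, h2] at h3
      calc _ ≤ _ := ih
        _ ≤ (ENNReal.ofReal |T (fun j => if j ∈ insert i S then loc0 x₀ r (f j) else f j) x| + D) +
            S.card * D := by
          gcongr
          refine (ENNReal.ofReal_le_ofReal h3).trans ?_
          rw [ENNReal.ofReal_add (abs_nonneg _) (abs_nonneg _)]
          gcongr
          exact hD S i
        _ = _ := by
          rw [Finset.card_insert_of_notMem hi]
          push_cast
          ring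
  simpa using key Finset.univ

/-- Passage from local to global boundedness, for any family of local functionals `N x r` obeying a
quasi-triangle inequality against constants. -/
lemma LB.exists_bound {p : ℝ} (hp0 : 0 < p) {ps : Fin m → ℝ} (hps : ∀ i, 1 ≤ ps i)
    {ωs : Fin m → Rn n → ℝ} {v : Rn n → ℝ} (hw : ∀ i, IsWeight (ωs i)) (hA : ∀ i, IsAinf (ωs i))
    (hAP : IsMultiAP p ps ωs) {φ1 : Fin m → Rn n → ℝ → ℝ} {φ2 : Rn n → ℝ → ℝ}
    (hcond : phiCond 0 ps φ1 ωs φ2) {T : (Fin m → Rn n → ℝ) → Rn n → ℝ} (hsub : MSublinear T)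
    (hsize : PointwiseSize T fun i f => MemMorrey (ps i) (φ1 i) (ωs i) f)
    {N : Rn n → ℝ → (Rn n → ℝ≥0∞) → ℝ≥0∞}
    (hN : ∀ (x : Rn n) (r : ℝ) (g a : Rn n → ℝ≥0∞) (c : ℝ≥0∞), (∀ y ∈ ball x r, g y ≤ a y + c) →
      N x r g ≤ 2 * 2 ^ (1 / p) * (N x r a + c * wMeas v (ball x r) ^ (1 / p)))
    (hLB : LB T (fun i f => MemMorrey (ps i) (φ1 i) (ωs i) f)
      (fun i f => morreyNorm (ps i) (φ1 i) (ωs i) f)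
      (fun g => ⨆ (x : Rn n) (r : ℝ) (_ : 0 < r), (ENNReal.ofReal (φ2 x r))⁻¹ *
        wMeas v (ball x r) ^ (-(1 / p)) * N x r fun y => ENNReal.ofReal |g y|)) :
    ∃ C : ℝ≥0, ∀ f : Fin m → Rn n → ℝ, (∀ i, MemMorrey (ps i) (φ1 i) (ωs i) (f i)) →
      (⨆ (x : Rn n) (r : ℝ) (_ : 0 < r), (ENNReal.ofReal (φ2 x r))⁻¹ *
        wMeas v (ball x r) ^ (-(1 / p)) * N x r fun y => ENNReal.ofReal |T f y|) ≤
      C * ∏ i, morreyNorm (ps i) (φ1 i) (ωs i) (f i) := by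
  obtain ⟨C₁, hC₁⟩ := exists_le_of_pointwiseSize hp0 hps hw hA hAP hcond hsize
  obtain ⟨C₂, hC₂⟩ := hLB
  refine ⟨2 * 2 ^ (1 / p) * (C₂ + m * C₁), fun f hf => iSup_le fun x₀ => iSup_le fun r =>
    iSup_le fun hr => ?_⟩
  have h0 (i : Fin m) : (0 : ℝ) ≤ ps i := zero_le_one.trans (hps i)
  obtain ⟨D, hDφ, hD⟩ := hC₁ x₀ r hr f hf
  set M := ∏ i, morreyNorm (ps i) (φ1 i) (ωs i) (f i)
  have hpt : ∀ y ∈ ball x₀ r, ENNReal.ofReal |T f y| ≤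
      ENNReal.ofReal |T (fun i => loc0 x₀ r (f i)) y| + m * D := by
    refine fun y hy => ofReal_abs_le_loc0_add hsub fun S i => hD _ (fun j => ?_) (fun j z => ?_)
      ⟨i, fun z hz => by simp [locInf, hz]⟩ y hy
    · rcases eq_or_ne j i with rfl | hj
      · simpa [locInf] using (hf j).indicator (h0 j) measurableSet_ball.compl
      · by_cases hS : j ∈ S
        · simpa [hj, hS, loc0] using (hf j).indicator (h0 j) measurableSet_ball
        · simpa [hj, hS] using hf j
    · rcases eq_or_ne j i with rfl | hj
      · simpa [locInf] using abs_indicator_le _ (f j) z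
      · by_cases hS : j ∈ S
        · simpa [hj, hS, loc0] using abs_indicator_le _ (f j) z
        · simp [hj, hS]
  set b := (ENNReal.ofReal (φ2 x₀ r))⁻¹
  set w := wMeas v (ball x₀ r)
  have hw1 : w ^ (-(1 / p)) * w ^ (1 / p) ≤ 1 := by
    rw [ENNReal.rpow_neg]
    exact ENNReal.inv_mul_le_one _
  have hloc : b * w ^ (-(1 / p)) * N x₀ r (fun y => ENNReal.ofReal |T (fun i => loc0 x₀ r (f i)) y|)
      ≤ C₂ * M := by
    refine le_trans ?_ (hC₂ x₀ r hr f hf)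
    refine le_iSup_of_le x₀ (le_iSup_of_le r ?_)
    rw [iSup_pos hr]
  calc _ ≤ b * w ^ (-(1 / p)) * (2 * 2 ^ (1 / p) *
        (N x₀ r (fun y => ENNReal.ofReal |T (fun i => loc0 x₀ r (f i)) y|) +
          m * D * w ^ (1 / p))) := by
        gcongr
        exact hN x₀ r _ _ _ hpt
    _ = 2 * 2 ^ (1 / p) * (b * w ^ (-(1 / p)) *
        N x₀ r (fun y => ENNReal.ofReal |T (fun i => loc0 x₀ r (f i)) y|) +
          m * (b * D) * (w ^ (-(1 / p)) * w ^ (1 / p))) := by ring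
    _ ≤ 2 * 2 ^ (1 / p) * (C₂ * M + m * (C₁ * M) * 1) := by gcongr
    _ = _ := by
        push_cast [ENNReal.coe_rpow_of_nonneg (2 : ℝ≥0) (by positivity : 0 ≤ 1 / p)]
        ring

lemma LB.of_bound {ps : Fin m → ℝ} (hps : ∀ i, 1 ≤ ps i) {ωs : Fin m → Rn n → ℝ}
    {φ1 : Fin m → Rn n → ℝ → ℝ} {T : (Fin m → Rn n → ℝ) → Rn n → ℝ} {Y : (Rn n → ℝ) → ℝ≥0∞}
    (h : ∃ C : ℝ≥0, ∀ f : Fin m → Rn n → ℝ, (∀ i, MemMorrey (ps i) (φ1 i) (ωs i) (f i)) →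
      Y (T f) ≤ C * ∏ i, morreyNorm (ps i) (φ1 i) (ωs i) (f i)) :
    LB T (fun i f => MemMorrey (ps i) (φ1 i) (ωs i) f)
      (fun i f => morreyNorm (ps i) (φ1 i) (ωs i) f) Y := by
  obtain ⟨C, hC⟩ := h
  refine ⟨C, fun x₀ r _ f hf => ?_⟩
  have h0 (i : Fin m) : (0 : ℝ) ≤ ps i := zero_le_one.trans (hps i)
  refine (hC _ fun i => (hf i).indicator (h0 i) measurableSet_ball).trans ?_
  gcongr with i
  exact morreyNorm_mono (h0 i) _ _ (abs_indicator_le _ _)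

lemma LB.exists_bound_of_isEmpty {T : (Fin 0 → Rn n → ℝ) → Rn n → ℝ}
    {X : Fin 0 → (Rn n → ℝ) → Prop} {Xnorm : Fin 0 → (Rn n → ℝ) → ℝ≥0∞}
    {Y : (Rn n → ℝ) → ℝ≥0∞} (h : LB T X Xnorm Y) :
    ∃ C : ℝ≥0, ∀ f : Fin 0 → Rn n → ℝ, (∀ i, X i (f i)) → Y (T f) ≤ C * ∏ i, Xnorm i (f i) := by
  obtain ⟨C, hC⟩ := h
  refine ⟨C, fun f hf => ?_⟩
  have := hC 0 1 one_pos f hf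
  rwa [Subsingleton.elim (fun i => loc0 0 1 (f i)) f] at this

/-- Corollary 1.1: for an `m`-sublinear operator satisfying the pointwise
size condition `(1.12)`, local boundedness on generalized weighted Morrey spaces is
*equivalent* to global boundedness, in both the strong (`min p_k > 1`) and the weak
(`min p_k = 1`) cases. -/
theorem stmt7 {n m : ℕ} (ps : Fin m → ℝ) (p : ℝ)
    (hps : ∀ k, 1 ≤ ps k) (hp : p⁻¹ = ∑ k, (ps k)⁻¹)
    (ωs : Fin m → Rn n → ℝ) (v : Rn n → ℝ)
    (hw : ∀ i, IsWeight (ωs i)) (hv : IsWeight v)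
    (hAP : IsMultiAP p ps ωs) (hAinf : ∀ i, IsAinf (ωs i))
    (φ1 : Fin m → Rn n → ℝ → ℝ) (φ2 : Rn n → ℝ → ℝ)
    (hφ1m : ∀ i, Measurable fun q : Rn n × ℝ => φ1 i q.1 q.2)
    (hφ2m : Measurable fun q : Rn n × ℝ => φ2 q.1 q.2)
    (hφ1 : ∀ i x r, 0 ≤ φ1 i x r) (hφ2 : ∀ x r, 0 ≤ φ2 x r)
    (hcond : phiCond 0 ps φ1 ωs φ2)
    (T : (Fin m → Rn n → ℝ) → Rn n → ℝ) (hsub : MSublinear T)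
    (hsize : PointwiseSize T fun i f => MemMorrey (ps i) (φ1 i) (ωs i) f) :
    ((∀ k, 1 < ps k) →
      (LB T (fun i f => MemMorrey (ps i) (φ1 i) (ωs i) f)
          (fun i f => morreyNorm (ps i) (φ1 i) (ωs i) f)
          (fun g => morreyNorm p φ2 v g) ↔
        ∃ C : ℝ≥0, ∀ f : Fin m → Rn n → ℝ,
          (∀ i, MemMorrey (ps i) (φ1 i) (ωs i) (f i)) →
          morreyNorm p φ2 v (T f) ≤ C * ∏ i, morreyNorm (ps i) (φ1 i) (ωs i) (f i))) ∧
    ((∃ k, ps k = 1) →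
      (LB T (fun i f => MemMorrey (ps i) (φ1 i) (ωs i) f)
          (fun i f => morreyNorm (ps i) (φ1 i) (ωs i) f)
          (fun g => weakMorreyNorm p φ2 v g) ↔
        ∃ C : ℝ≥0, ∀ f : Fin m → Rn n → ℝ,
          (∀ i, MemMorrey (ps i) (φ1 i) (ωs i) (f i)) →
          weakMorreyNorm p φ2 v (T f) ≤
            C * ∏ i, morreyNorm (ps i) (φ1 i) (ωs i) (f i))) := by
  have hp0 (hm : m ≠ 0) : 0 < p := by
    have : Nonempty (Fin m) := Fin.pos_iff_nonempty.1 (Nat.pos_of_ne_zero hm)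
    refine inv_pos.1 (hp ▸ Finset.sum_pos (fun k _ => ?_) Finset.univ_nonempty)
    exact inv_pos.2 (zero_lt_one.trans_le (hps k))
  refine ⟨fun _ => ⟨fun h => ?_, LB.of_bound hps⟩, fun ⟨k, _⟩ => ⟨fun h => ?_, LB.of_bound hps⟩⟩
  · rcases eq_or_ne m 0 with rfl | hm
    · exact LB.exists_bound_of_isEmpty h
    · exact LB.exists_bound (hp0 hm) hps hw hAinf hAP hcond hsub hsize
        (N := fun x r g => wLpNormE p v (ball x r) g)
        (fun x r g a c hg => wLpNormE_le_add_const (hp0 hm) hv.aemeasurable measurableSet_ball hg) h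
  · have hm : m ≠ 0 := (Fin.pos k).ne'
    exact LB.exists_bound (hp0 hm) hps hw hAinf hAP hcond hsub hsize
      (N := fun x r g => wWeakLpNormE p v (ball x r) g)
      (fun x r g a c hg => wWeakLpNormE_le_add_const (hp0 hm) v hg) h
end GWM
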